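/- arXiv:1709.06724 — 11 statements merged into one kernel-verified Lean document; each statement's English description precedes it below -/
import Mathlib

section
/- Let f ∈ ℤ[x] be a monic polynomial of degree n and let g ∈ ℤ[x] be a nonzero polynomial of degree < n that is coprime to f over ℚ. Then the coefficient vectors of x^i·g(x) mod f(x), for i = 0,…,n−1, are ℤ-linearly independent; equivalently, the ideal lattice generated by g is a full-rank subgroup of ℤ^n. -/
open Polynomial

/-- For `f` monic of degree `n` and `g ≠ 0` of degree `< n` coprime to `f`
over `ℚ`, the coefficient vectors of `x^i·g mod f` for `i = 0,…,n−1` are `ℤ`-linearly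
independent, i.e. the ideal lattice generated by `g` is full-rank. -/
theorem ideal_lattice_full_rank
    (n : ℕ) (f g : Polynomial ℤ)
    (hf : f.Monic) (hfdeg : f.natDegree = n)
    (hg : g ≠ 0) (hgdeg : g.natDegree < n)
    (hcop : IsCoprime (g.map (Int.castRingHom ℚ)) (f.map (Int.castRingHom ℚ))) :
    LinearIndependent ℤ
      (fun i : Fin n => fun j : Fin n => ((X ^ (i : ℕ) * g) %ₘ f).coeff (j : ℕ)) := by
  rw [Fintype.linearIndependent_iff]
  intro c hc
  set P : ℤ[X] := ∑ i : Fin n, c i • X ^ (i : ℕ) with hP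
  have hfd : f.degree = n := by rw [degree_eq_natDegree hf.ne_zero, hfdeg]
  have hsum : (P * g) %ₘ f = ∑ i : Fin n, c i • ((X ^ (i : ℕ) * g) %ₘ f) := by
    change modByMonicHom f (P * g) = ∑ i : Fin n, c i • modByMonicHom f (X ^ (i : ℕ) * g)
    simp only [hP, Finset.sum_mul, smul_mul_assoc, map_sum, map_smul]
  have hmod : (P * g) %ₘ f = 0 := by
    ext j
    rw [coeff_zero]
    by_cases hj : j < n
    · have h := congrFun hc ⟨j, hj⟩
      simp only [Finset.sum_apply, Pi.smul_apply, Pi.zero_apply] at h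
      simpa only [hsum, finsetSum_coeff, coeff_smul] using h
    · refine coeff_eq_zero_of_degree_lt ((degree_modByMonic_lt _ hf).trans_le ?_)
      rw [hfd]
      exact_mod_cast not_lt.mp hj
  have hdvd : f.map (Int.castRingHom ℚ) ∣ P.map (Int.castRingHom ℚ) := by
    refine hcop.symm.dvd_of_dvd_mul_right ?_
    rw [← Polynomial.map_mul]
    exact Polynomial.map_dvd _ ((modByMonic_eq_zero_iff_dvd hf).mp hmod)
  have hPdeg : P.degree < n := by
    refine (degree_sum_le _ _).trans_lt ((Finset.sup_lt_iff (WithBot.bot_lt_coe n)).mpr ?_)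
    intro i _
    refine (degree_smul_le _ _).trans_lt ?_
    rw [degree_X_pow]
    exact Nat.cast_lt.mpr i.isLt
  have hP0 : P = 0 := by
    have hinj : Function.Injective (Int.castRingHom ℚ) := Int.cast_injective
    rw [← Polynomial.map_eq_zero_iff hinj]
    refine eq_zero_of_dvd_of_degree_lt hdvd ?_
    rwa [degree_map_eq_of_injective hinj, degree_map_eq_of_injective hinj, hfd]
  intro i
  have h := congrArg (fun p : ℤ[X] => p.coeff i) hP0
  simpa [hP, finsetSum_coeff, coeff_X_pow, Fin.val_inj] using h
end

section
/- Let f ∈ ℤ[x] be monic of degree n, and let H be an n×n nonsingular integer matrix in Hermite Normal Form (lower-triangular convention) whose rows span an ideal lattice for f, i.e., the ℤ-span L of the rows of H is closed under the ℤ-linear map T_f sending the coefficient vector of a polynomial p of degree < n to the coefficient vector of x·p mod f. Then h_{i,i} divides h_{j,l} for all indices with 1 ≤ l ≤ j ≤ i ≤ n. -/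
open Polynomial

/-- The coefficient of `X ^ a` in `∑ k, v k X ^ k`. -/
theorem coeff_sum_fin_C_mul_X_pow {n : ℕ} (v : Fin n → ℤ) (a : ℕ) :
    (∑ k : Fin n, C (v k) * X ^ (k : ℕ)).coeff a = if h : a < n then v ⟨a, h⟩ else 0 := by
  simp only [finsetSum_coeff, coeff_C_mul, coeff_X_pow, mul_ite, mul_one, mul_zero]
  split_ifs with h
  · rw [Finset.sum_eq_single ⟨a, h⟩]
    · simp
    · intro b _ hb
      rw [if_neg]
      rintro rfl
      exact hb rfl
    · simp
  · refine Finset.sum_eq_zero fun k _ => if_neg ?_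
    have := k.isLt
    omega

/-- Multiplying by `X` modulo a monic `f` of degree `n` needs no reduction when the
coefficient of `X ^ (n - 1)` vanishes. -/
theorem X_mul_sum_modByMonic_eq_self {n : ℕ} {f : ℤ[X]} (hf : f.Monic) (hfdeg : f.natDegree = n)
    (v : Fin n → ℤ) (hv : ∀ k : Fin n, (k : ℕ) + 1 = n → v k = 0) :
    (X * ∑ k : Fin n, C (v k) * X ^ (k : ℕ)) %ₘ f = X * ∑ k : Fin n, C (v k) * X ^ (k : ℕ) := by
  rw [modByMonic_eq_self_iff hf, degree_eq_natDegree hf.ne_zero, hfdeg, degree_lt_iff_coeff_zero]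
  rintro (_ | a) ha
  · simp
  · rw [coeff_X_mul, coeff_sum_fin_C_mul_X_pow]
    split_ifs with h
    · exact hv _ (by simp only; omega)
    · rfl

/-- If an integer combination of the rows of a lower-triangular matrix with nonzero diagonal
vanishes beyond position `m`, then so do its coefficients. -/
theorem coeff_eq_zero_of_lowerTriangular {n : ℕ} {H : Matrix (Fin n) (Fin n) ℤ}
    (hdiag : ∀ i, H i i ≠ 0) (hupper : ∀ j i, j < i → H j i = 0) {c : Fin n → ℤ} {m : Fin n}
    (hc : ∀ k, m < k → ∑ i, c i * H i k = 0) (k : Fin n) (hk : m < k) : c k = 0 := by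
  induction k using WellFoundedGT.induction with
  | ind k ih =>
    have h := hc k hk
    rw [Finset.sum_eq_single k] at h
    · exact (mul_eq_zero.mp h).resolve_right (hdiag k)
    · intro b _ hb
      rcases lt_or_gt_of_ne hb with hlt | hgt
      · rw [hupper b k hlt, mul_zero]
      · rw [ih b hgt (hk.trans hgt), zero_mul]
    · simp

/-- Let `v` be an integer combination of the rows of a lower-triangular matrix `H` with leading
position `m`. If a nonzero `d` divides `v` and all rows above row `m`, and `v m = d`, then
`H m m` divides `d` and row `m`. -/
theorem diag_dvd_of_mem_span {n : ℕ} {H : Matrix (Fin n) (Fin n) ℤ}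
    (hdiag : ∀ i, H i i ≠ 0) (hupper : ∀ j i, j < i → H j i = 0) {v : Fin n → ℤ} {m : Fin n} {d : ℤ}
    (hd : d ≠ 0) (hv : v ∈ Submodule.span ℤ (Set.range fun i : Fin n => H i))
    (hvm : v m = d) (hv0 : ∀ k, m < k → v k = 0) (hdv : ∀ k, d ∣ v k)
    (hdH : ∀ j < m, ∀ l, d ∣ H j l) : H m m ∣ d ∧ ∀ l, H m m ∣ H m l := by
  obtain ⟨c, rfl⟩ := (Submodule.mem_span_range_iff_exists_fun ℤ).mp hv
  simp only [Finset.sum_apply, Pi.smul_apply, smul_eq_mul] at hvm hv0 hdv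
  have hc := coeff_eq_zero_of_lowerTriangular hdiag hupper hv0
  have hcm : c m * H m m = d := by
    rw [← hvm, Finset.sum_eq_single m]
    · intro b _ hb
      rcases lt_or_gt_of_ne hb with hlt | hgt
      · rw [hupper b m hlt, mul_zero]
      · rw [hc b hgt, zero_mul]
    · simp
  refine ⟨⟨c m, by rw [← hcm, mul_comm]⟩, fun l => ?_⟩
  have hsum : d ∣ ∑ i ∈ Finset.univ.erase m, c i * H i l := by
    refine Finset.dvd_sum fun i hi => ?_
    rcases lt_or_gt_of_ne (Finset.ne_of_mem_erase hi) with hlt | hgt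
    · exact (hdH i hlt l).mul_left _
    · simp [hc i hgt]
  have hrow : d ∣ c m * H m l := by
    have h := hdv l
    rwa [← Finset.add_sum_erase _ _ (Finset.mem_univ m), dvd_add_left hsum] at h
  rw [← hcm] at hrow hd
  exact (mul_dvd_mul_iff_left (left_ne_zero_of_mul hd)).mp hrow


/-- If `H` is a nonsingular integer matrix in Hermite Normal Form
(lower-triangular convention) whose rows span an ideal lattice for a monic `f` of degree
`n` (i.e. the ℤ-span of the rows is closed under `p ↦ x·p mod f` on coefficient vectors),
then `h_{i,i} ∣ h_{j,l}` whenever `l ≤ j ≤ i`. -/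
theorem hnf_ideal_lattice_diag_dvd
    (n : ℕ) (f : Polynomial ℤ) (hf : f.Monic) (hfdeg : f.natDegree = n)
    (H : Matrix (Fin n) (Fin n) ℤ)
    (hdet : H.det ≠ 0)
    (hdiagpos : ∀ i : Fin n, 0 < H i i)
    (hupper : ∀ j i : Fin n, j < i → H j i = 0)
    (hreduced : ∀ i j : Fin n, i < j → 0 ≤ H j i ∧ H j i < H i i)
    (hclosed : ∀ v : Fin n → ℤ,
      v ∈ Submodule.span ℤ (Set.range fun i : Fin n => H i) →
      (fun j : Fin n => ((X * ∑ k : Fin n, C (v k) * X ^ (k : ℕ)) %ₘ f).coeff (j : ℕ))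
        ∈ Submodule.span ℤ (Set.range fun i : Fin n => H i)) :
    ∀ l j i : Fin n, l ≤ j → j ≤ i → H i i ∣ H j l := by
  have hdiag : ∀ i, H i i ≠ 0 := fun i => (hdiagpos i).ne'
  have key : ∀ (m : ℕ) (hm : m < n) (j : Fin n), j ≤ ⟨m, hm⟩ → ∀ l,
      H ⟨m, hm⟩ ⟨m, hm⟩ ∣ H j l := by
    intro m
    induction m with
    | zero =>
      intro hm j hj l
      obtain rfl : j = ⟨0, hm⟩ := le_antisymm hj (Fin.le_def.mpr (Nat.zero_le _))
      rcases eq_or_lt_of_le (Fin.le_def.mpr (Nat.zero_le _) : (⟨0, hm⟩ : Fin n) ≤ l) with h | h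
      · rw [← h]
      · simp [hupper _ _ h]
    | succ m ih =>
      intro hm j hj l
      have hm' : m < n := by omega
      have hmem := hclosed (H ⟨m, hm'⟩) (Submodule.subset_span ⟨_, rfl⟩)
      rw [X_mul_sum_modByMonic_eq_self hf hfdeg _
        fun k hk => hupper _ _ (Fin.lt_def.mpr (by simp only; omega))] at hmem
      have hlast := diag_dvd_of_mem_span hdiag hupper (m := ⟨m + 1, hm⟩) (hdiag ⟨m, hm'⟩) hmem
        (by simp only [coeff_X_mul, coeff_sum_fin_C_mul_X_pow, hm', dite_true])
        (by
          rintro ⟨_ | k, hk⟩ hlt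
          · simp
          · rw [coeff_X_mul, coeff_sum_fin_C_mul_X_pow, dif_pos (by omega)]
            exact hupper _ _ (by simpa using hlt))
        (by
          rintro ⟨_ | k, hk⟩
          · simp
          · rw [coeff_X_mul, coeff_sum_fin_C_mul_X_pow, dif_pos (by omega)]
            exact ih hm' _ le_rfl _)
        (fun j hj l => ih hm' j (Fin.le_def.mpr (Nat.lt_succ_iff.mp (Fin.lt_def.mp hj))) l)
      rcases eq_or_lt_of_le hj with rfl | hlt
      · exact hlast.2 l
      · exact hlast.1.trans
          (ih hm' j (Fin.le_def.mpr (Nat.lt_succ_iff.mp (Fin.lt_def.mp hlt))) l)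
  exact fun l j i _ hji => key i i.isLt j hji l
end

section
/- Let n be a power of 2 and v_0,…,v_{n−1} ∈ ℤ. Let V be the n×n negacyclic matrix of v, i.e., V_{i,j} = v_{j−i} if j ≥ i and V_{i,j} = −v_{n+j−i} if j < i (indices 0,…,n−1), so the i-th row of V is the coefficient vector of x^i·v(x) mod (x^n+1) where v(x) = v_0 + v_1x + ⋯ + v_{n−1}x^{n−1}. Then det V ≡ v_0 + v_1 + ⋯ + v_{n−1} (mod 2). -/
namespace Matrix

variable {G R : Type*} [AddCommGroup G] [Fintype G] [DecidableEq G]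

theorem circulant_single_one_mul [NonAssocSemiring R] (a b : G) :
    circulant (Pi.single a (1 : R)) * circulant (Pi.single b 1) =
      circulant (Pi.single (a + b) 1) := by
  rw [circulant_mul, mulVec_single_one]
  congr 1
  ext i
  simp [circulant_apply, Pi.single_apply, sub_eq_iff_eq_add]

theorem circulant_single_one_pow [Semiring R] (a : G) (m : ℕ) :
    circulant (Pi.single a (1 : R)) ^ m = circulant (Pi.single (m • a) 1) := by
  induction m with
  | zero => simp
  | succ m ih => rw [pow_succ, ih, circulant_single_one_mul, succ_nsmul]

theorem circulant_eq_sum_smul [Semiring R] (v : G → R) :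
    circulant v = ∑ a, v a • circulant (Pi.single a (1 : R)) := by
  ext i j
  simp [Matrix.sum_apply, circulant_apply, Pi.single_apply]

/-- In characteristic `p`, raising a circulant matrix indexed by a finite abelian `p`-group to the order
of the group gives a scalar matrix. -/
theorem circulant_pow_card [CommRing R] (p k : ℕ) [Fact p.Prime] [CharP R p]
    (hG : Fintype.card G = p ^ k) (v : G → R) :
    circulant v ^ p ^ k = (∑ a, v a) ^ p ^ k • (1 : Matrix G G R) := by
  have key (s : Finset G) :
      (∑ a ∈ s, v a • circulant (Pi.single a (1 : R))) ^ p ^ k =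
        (∑ a ∈ s, v a) ^ p ^ k • (1 : Matrix G G R) := by
    induction s using Finset.induction_on with
    | empty => simp [(Fact.out : p.Prime).ne_zero]
    | insert a s ha ih =>
      have hcomm : Commute (v a • circulant (Pi.single a (1 : R)))
          (∑ b ∈ s, v b • circulant (Pi.single b (1 : R))) :=
        Commute.sum_right _ _ _ fun b _ ↦ by
          refine Commute.smul_left (Commute.smul_right ?_ _) _
          exact (commute_iff_eq _ _).mpr (circulant_mul_comm _ _)
      rw [Finset.sum_insert ha, Finset.sum_insert ha, add_pow_char_pow_of_commute _ _ hcomm, ih,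
        add_pow_char_pow, add_smul, smul_pow, circulant_single_one_pow, ← hG, card_nsmul_eq_zero,
        circulant_single_one]
  rw [circulant_eq_sum_smul, key]

theorem det_circulant_zmod (p k : ℕ) [Fact p.Prime] (hG : Fintype.card G = p ^ k)
    (v : G → ZMod p) : (circulant v).det = ∑ a, v a := by
  rw [← ZMod.pow_card_pow (n := k) (circulant v).det, ← det_pow, circulant_pow_card p k hG,
    ZMod.pow_card_pow, det_smul, det_one, mul_one, hG, ZMod.pow_card_pow]

end Matrix

/-- Let `n` be a power of 2 and `V` the negacyclic matrix of
`v = (v_0,…,v_{n−1}) ∈ ℤ^n`, i.e. `V_{i,j} = v_{j−i}` if `j ≥ i` and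
`V_{i,j} = −v_{n+j−i}` if `j < i` (equivalently, entry `(i,j)` is `±v_{j−i mod n}`
with sign `−1` exactly when `j < i`; the `i`-th row is the coefficient vector of
`x^i·v(x) mod (x^n+1)`). Then `det V ≡ v_0 + v_1 + ⋯ + v_{n−1} (mod 2)`. -/
theorem negacyclic_det_parity
    (n : ℕ) (hn : ∃ k : ℕ, n = 2 ^ k)
    (v : Fin n → ℤ)
    (V : Matrix (Fin n) (Fin n) ℤ)
    (hV : ∀ i j : Fin n, V i j = if (i : ℕ) ≤ (j : ℕ) then v (j - i) else -(v (j - i))) :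
    V.det ≡ ∑ i : Fin n, v i [ZMOD 2] := by
  obtain ⟨k, rfl⟩ := hn
  have hmap : V.map (Int.cast : ℤ → ZMod 2) =
      (Matrix.circulant fun i ↦ (v i : ZMod 2)).transpose := by
    ext i j
    rw [Matrix.map_apply, hV, Matrix.transpose_apply, Matrix.circulant_apply]
    split_ifs <;> simp [ZMod.neg_eq_self_mod_two]
  refine (ZMod.intCast_eq_intCast_iff V.det _ 2).mp ?_
  rw [Int.cast_det, hmap, Matrix.det_transpose,
    Matrix.det_circulant_zmod 2 k (Fintype.card_fin _), Int.cast_sum]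
end

section
/- Let n be a power of 2 and v ∈ ℤ[x] a polynomial of degree < n. Then Res(v, x^n+1) ≡ v(1) (mod 2), i.e., the resultant of v and x^n + 1 is congruent modulo 2 to the sum of the coefficients of v. -/
open Polynomial Matrix

/-- The Sylvester matrix of `a` and `b` (with `m = deg a`, `n = deg b`):
an `(n + m) × (n + m)` integer matrix whose first `n` rows are the coefficient
vectors of `a, x·a, …, x^{n-1}·a` and whose last `m` rows are the coefficient
vectors of `b, x·b, …, x^{m-1}·b`. -/
noncomputable def sylvesterMatrix (a b : Polynomial ℤ) :
    Matrix (Fin (b.natDegree + a.natDegree)) (Fin (b.natDegree + a.natDegree)) ℤ :=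
  Matrix.of fun i j =>
    if (i : ℕ) < b.natDegree then
      (if (i : ℕ) ≤ (j : ℕ) then a.coeff ((j : ℕ) - (i : ℕ)) else 0)
    else
      (if (i : ℕ) - b.natDegree ≤ (j : ℕ) then b.coeff ((j : ℕ) - ((i : ℕ) - b.natDegree)) else 0)

/-- The resultant of two integer polynomials: the determinant of their Sylvester matrix. -/
noncomputable def resultantZ (a b : Polynomial ℤ) : ℤ := (sylvesterMatrix a b).det

theorem sylvesterMatrix_eq_transpose_sylvester (a b : Polynomial ℤ) :
    sylvesterMatrix a b = (sylvester b a b.natDegree a.natDegree)ᵀ := by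
  ext i j
  rw [transpose_apply]
  induction i using Fin.addCases with
  | left i =>
    simp only [sylvesterMatrix, sylvester, of_apply, Fin.val_castAdd, i.isLt, if_true,
      Fin.addCases_left, Set.mem_Icc]
    by_cases h : (j : ℕ) ≤ i + a.natDegree
    · simp [h]
    · simp only [h, and_false, if_false, ite_eq_right_iff]
      exact fun _ => coeff_eq_zero_of_natDegree_lt (by omega)
  | right i =>
    simp only [sylvesterMatrix, sylvester, of_apply, Fin.val_natAdd, Fin.addCases_right,
      Set.mem_Icc, Nat.not_lt.mpr (Nat.le_add_right _ _), if_false, Nat.add_sub_cancel_left]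
    by_cases h : (j : ℕ) ≤ i + b.natDegree
    · simp [h]
    · simp only [h, and_false, if_false, ite_eq_right_iff]
      exact fun _ => coeff_eq_zero_of_natDegree_lt (by omega)

theorem resultantZ_eq_resultant (a b : Polynomial ℤ) : resultantZ a b = resultant b a := by
  rw [resultantZ, sylvesterMatrix_eq_transpose_sylvester, det_transpose, resultant]

theorem zmod_two_pow_eq_self (x : ZMod 2) {n : ℕ} (hn : n ≠ 0) : x ^ n = x := by
  fin_cases x
  · exact zero_pow hn
  · exact one_pow n

/-- For `n` a power of 2 and `v ∈ ℤ[x]` of degree `< n`,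
`Res(v, x^n+1) ≡ v(1) (mod 2)`: the resultant of `v` and `x^n + 1` is congruent mod 2
to the sum of the coefficients of `v`. -/
theorem resultant_negacyclic_parity
    (n : ℕ) (hn : ∃ k : ℕ, n = 2 ^ k)
    (v : Polynomial ℤ) (hv : v.natDegree < n) :
    resultantZ v (X ^ n + 1) ≡ v.eval 1 [ZMOD 2] := by
  obtain ⟨k, rfl⟩ := hn
  refine (ZMod.intCast_eq_intCast_iff _ _ 2).mp ?_
  rw [resultantZ_eq_resultant,
    ← eq_intCast (Int.castRingHom (ZMod 2)), ← resultant_map_map]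
  have hdeg : (X ^ 2 ^ k + 1 : ℤ[X]).natDegree = 2 ^ k := natDegree_X_pow_add_C (r := 1)
  have hmap : (X ^ 2 ^ k + 1 : ℤ[X]).map (Int.castRingHom (ZMod 2)) = (X - C 1) ^ 2 ^ k := by
    rw [sub_pow_char_pow, C_1, one_pow, CharTwo.sub_eq_add]
    simp
  rw [hdeg, hmap, resultant_X_sub_C_pow_left _ _ _ _ natDegree_map_le,
    zmod_two_pow_eq_self _ (by positivity), eval_one_map]
  rfl
end

section
/- Let n be a power of 2, f = x^n + 1, and v ∈ ℤ[x] of degree < n with d = Res(v,f) ≠ 0. Let w = w_0 + w_1x + ⋯ + w_{n−1}x^{n−1} ∈ ℤ[x] be the polynomial of degree < n with v(x)·w(x) ≡ d (mod x^n + 1). Then the following are equivalent: (i) there exists r ∈ ℤ such that x − r lies in the ideal I generated by v in ℤ[x]/(x^n+1); (ii) there exists an index i with 0 ≤ i ≤ n−1 such that gcd(w_i, d) = 1; (iii) for every index i with 0 ≤ i ≤ n−1, gcd(w_i, d) = 1. -/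
open Polynomial Matrix

/-- The vanishing modulo `det S` of the `2 × 2` minors of the adjugate of `S`, in terms of two
vectors `a`, `b` in the span of its rows. -/
theorem det_dvd_minor {ι R : Type*} [Fintype ι] [DecidableEq ι] [CommRing R] [IsDomain R]
    (S : Matrix ι ι R) (hS : S.det ≠ 0) {a b p q : ι → R}
    (ha : a ᵥ* S = S.det • p) (hb : b ᵥ* S = S.det • q) {i j : ι} (hij : i ≠ j) :
    S.det ∣ a i * b j - a j * b i := by
  let U : Matrix ι (Fin 2) R := Matrix.of fun k l => if k = ![i, j] l then 1 else 0
  let V : Matrix (Fin 2) ι R := Matrix.of ![a - Pi.single i 1, b - Pi.single j 1]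
  have hdet : (1 + U * V).det = a i * b j - a j * b i := by
    rw [Matrix.det_one_add_mul_comm, Matrix.det_fin_two]
    have hVU : ∀ k l, (V * U) k l = V k (![i, j] l) := fun k l => by
      simp [U, Matrix.mul_apply]
    simp only [Matrix.add_apply, hVU]
    simp [V, hij, hij.symm]
  have hmul : (1 + U * V) * S =
      (S.updateRow i (S.det • p)).updateRow j (S.det • q) := by
    have hVS0 : (V * S) 0 = S.det • p - S i := by
      change (a - Pi.single i 1) ᵥ* S = _
      rw [Matrix.sub_vecMul, ha, Matrix.single_one_vecMul]; rfl
    have hVS1 : (V * S) 1 = S.det • q - S j := by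
      change (b - Pi.single j 1) ᵥ* S = _
      rw [Matrix.sub_vecMul, hb, Matrix.single_one_vecMul]; rfl
    rw [add_mul, one_mul, Matrix.mul_assoc]
    ext k l
    rw [Matrix.add_apply, Matrix.mul_apply, Fin.sum_univ_two, hVS0, hVS1]
    by_cases hkj : k = j
    · subst hkj
      simp [U, hij.symm]
    · by_cases hki : k = i
      · subst hki
        simp [U, hij]
      · simp [U, hki, hkj]
  have h := congrArg Matrix.det hmul
  rw [Matrix.det_mul, hdet, Matrix.det_updateRow_smul, Matrix.updateRow_comm _ hij,
    Matrix.det_updateRow_smul, mul_comm] at h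
  exact ⟨_, mul_left_cancel₀ hS h⟩

theorem sum_coeff_mul_coeff_X_pow_mul {R : Type*} [CommSemiring R] {p : R[X]} {n : ℕ}
    (hp : p.degree < n) (a : R[X]) (j : ℕ) :
    ∑ i : Fin n, p.coeff i * (X ^ (i : ℕ) * a).coeff j = (p * a).coeff j := by
  have h : p = ∑ i ∈ Finset.range n, C (p.coeff i) * X ^ i := by
    ext k
    simp only [finsetSum_coeff, coeff_C_mul_X_pow, Finset.sum_ite_eq, Finset.mem_range]
    split_ifs with hk
    · rfl
    · exact coeff_eq_zero_of_degree_lt (hp.trans_le (by exact_mod_cast not_lt.mp hk))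
  conv_rhs => rw [h, Finset.sum_mul, finsetSum_coeff]
  rw [Fin.sum_univ_eq_sum_range (fun i => p.coeff i * ((X : R[X]) ^ i * a).coeff j) n]
  simp [mul_assoc]

theorem exists_vecMul_sylvesterMatrix {a b s t : ℤ[X]} (hb : b.Monic) (hs : s.degree < b.degree)
    (hu : (s * a + t * b).degree < ((b.natDegree + a.natDegree : ℕ) : WithBot ℕ)) :
    ∃ c : Fin (b.natDegree + a.natDegree) → ℤ,
      (∀ i : Fin _, (i : ℕ) < b.natDegree → c i = s.coeff i) ∧
      c ᵥ* sylvesterMatrix a b = fun j : Fin _ => (s * a + t * b).coeff j := by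
  have hs' : s.degree < (b.natDegree : WithBot ℕ) := by
    rwa [← degree_eq_natDegree hb.ne_zero]
  have hsa : (s * a).degree < ((b.natDegree + a.natDegree : ℕ) : WithBot ℕ) := by
    rw [degree_lt_iff_coeff_zero]
    intro m hm
    rw [coeff_mul]
    refine Finset.sum_eq_zero fun x hx => ?_
    rw [Finset.HasAntidiagonal.mem_antidiagonal] at hx
    by_cases h : b.natDegree ≤ x.1
    · rw [(degree_lt_iff_coeff_zero _ _).1 hs' _ h, zero_mul]
    · rw [coeff_eq_zero_of_natDegree_lt (by omega : a.natDegree < x.2), mul_zero]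
  have ht : t.degree < (a.natDegree : WithBot ℕ) := by
    have htb : (t * b).degree < ((b.natDegree + a.natDegree : ℕ) : WithBot ℕ) := by
      have : t * b = (s * a + t * b) - s * a := by ring
      rw [this]
      exact (degree_sub_le _ _).trans_lt (max_lt hu hsa)
    rcases eq_or_ne t 0 with rfl | h0
    · simp
    · rw [hb.degree_mul, degree_eq_natDegree h0, degree_eq_natDegree hb.ne_zero] at htb
      rw [degree_eq_natDegree h0]
      norm_cast at htb ⊢
      omega
  refine ⟨fun i => if (i : ℕ) < b.natDegree then s.coeff i else t.coeff (i - b.natDegree),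
    fun i hi => if_pos hi, ?_⟩
  ext j
  rw [coeff_add, ← sum_coeff_mul_coeff_X_pow_mul hs', ← sum_coeff_mul_coeff_X_pow_mul ht,
    Matrix.vecMul, dotProduct, Fin.sum_univ_add]
  congr 1
  · simp [sylvesterMatrix, coeff_X_pow_mul', -Fin.val_fin_le]
  · simp [sylvesterMatrix, coeff_X_pow_mul', add_comm b.natDegree]

theorem exists_degree_lt_of_mem_span_pair {R : Type*} [CommRing R] [Nontrivial R] {a b u : R[X]}
    (hb : b.Monic) (h : u ∈ Ideal.span {a, b}) : ∃ s t, s.degree < b.degree ∧ s * a + t * b = u := by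
  obtain ⟨s, t, rfl⟩ := Ideal.mem_span_pair.1 h
  refine ⟨s %ₘ b, t + (s /ₘ b) * a, degree_modByMonic_lt _ hb, ?_⟩
  linear_combination a * modByMonic_add_div s b

/-- If `x - r` and the constant `m` both lie in `(a, b)`, then `Res(a, b)` divides `m`. -/
theorem resultantZ_dvd_of_mem_span {a b : ℤ[X]} (hb : b.Monic) (hb0 : 0 < b.natDegree) {r m : ℤ}
    (hr : X - C r ∈ Ideal.span {a, b}) (hm : C m ∈ Ideal.span {a, b}) :
    resultantZ a b ∣ m := by
  let u : ℕ → ℤ[X] := fun j => if j = 0 then C m else X ^ j - C (r ^ j)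
  have hu : ∀ j, u j ∈ Ideal.span {a, b} := by
    intro j
    by_cases hj : j = 0
    · simpa [u, hj] using hm
    · simp only [u, hj, if_false, C_pow]
      exact Ideal.mem_of_dvd _ (sub_dvd_pow_sub_pow _ _ _) hr
  have hcoeff : ∀ j k, j ≤ k → (u j).coeff k = if j = k then (if j = 0 then m else 1) else 0 := by
    intro j k hjk
    by_cases hj : j = 0
    · simp only [u, hj, if_true, coeff_C, eq_comm]
    · have hk : k ≠ 0 := by omega
      simp only [u, hj, if_false, coeff_sub, coeff_C, coeff_X_pow, hk, sub_zero, eq_comm]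
  have hdeg : ∀ j : Fin (b.natDegree + a.natDegree),
      (u j).degree < ((b.natDegree + a.natDegree : ℕ) : WithBot ℕ) := by
    intro j
    rw [degree_lt_iff_coeff_zero]
    intro k hk
    have := j.2
    rw [hcoeff _ _ (by omega), if_neg (by omega)]
  have hrow : ∀ j : Fin (b.natDegree + a.natDegree),
      ∃ c, c ᵥ* sylvesterMatrix a b = fun k : Fin _ => (u j).coeff k := by
    intro j
    obtain ⟨s, t, hs, hst⟩ := exists_degree_lt_of_mem_span_pair hb (hu j)
    obtain ⟨c, -, hc⟩ := exists_vecMul_sylvesterMatrix hb hs (hst ▸ hdeg j)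
    exact ⟨c, by rw [hc, hst]⟩
  choose A hA using hrow
  have hB : (Matrix.of A * sylvesterMatrix a b).det = m := by
    have hentry : ∀ j k, (Matrix.of A * sylvesterMatrix a b) j k = (u j).coeff k :=
      fun j k => congrFun (hA j) k
    rw [Matrix.det_of_isLowerTriangular]
    · have : NeZero (b.natDegree + a.natDegree) := ⟨by omega⟩
      simp_rw [hentry, hcoeff _ _ le_rfl, if_true]
      rw [Finset.prod_eq_single 0]
      · simp
      · intro j _ hj
        rw [if_neg]
        exact fun h => hj (Fin.ext (by simpa using h))
      · simp
    · intro j k hjk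
      have hjk' : (j : ℕ) < k := hjk
      rw [hentry, hcoeff _ _ hjk'.le, if_neg hjk'.ne]
  rw [Matrix.det_mul] at hB
  exact Dvd.intro_left _ hB

theorem Polynomial.Monic.dvd_of_dvd_C_mul {R : Type*} [CommRing R] [IsDomain R] {f u : R[X]}
    (hf : f.Monic) {c : R} (hc : c ≠ 0) (h : f ∣ C c * u) : f ∣ u := by
  rw [← modByMonic_eq_zero_iff_dvd hf] at h ⊢
  rw [← smul_eq_C_mul, smul_modByMonic] at h
  exact (smul_eq_zero.1 h).resolve_left hc

theorem mk_mem_span_mk_iff {R : Type*} [CommRing R] {f u v : R} :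
    Ideal.Quotient.mk (Ideal.span {f}) u ∈ Ideal.span {Ideal.Quotient.mk (Ideal.span {f}) v} ↔
      ∃ s, f ∣ u - s * v := by
  rw [Ideal.mem_span_singleton']
  constructor
  · rintro ⟨y, hy⟩
    obtain ⟨s, rfl⟩ := Ideal.Quotient.mk_surjective y
    rw [← map_mul, eq_comm, Ideal.Quotient.eq, Ideal.mem_span_singleton] at hy
    exact ⟨s, hy⟩
  · rintro ⟨s, hs⟩
    refine ⟨Ideal.Quotient.mk _ s, ?_⟩
    rw [← map_mul, eq_comm, Ideal.Quotient.eq, Ideal.mem_span_singleton]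
    exact hs

/-- The reduction of `x * w` modulo `x ^ n + 1`, for `w` of degree less than `n`. -/
noncomputable def negacyclicShift (n : ℕ) (w : ℤ[X]) : ℤ[X] :=
  X * w - C (w.coeff (n - 1)) * (X ^ n + 1)

theorem coeff_zero_negacyclicShift {n : ℕ} (hn : n ≠ 0) (w : ℤ[X]) :
    (negacyclicShift n w).coeff 0 = -w.coeff (n - 1) := by
  simp [negacyclicShift, coeff_X_pow, hn.symm]

theorem coeff_succ_negacyclicShift {n j : ℕ} (hj : j + 1 < n) (w : ℤ[X]) :
    (negacyclicShift n w).coeff (j + 1) = w.coeff j := by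
  simp [negacyclicShift, coeff_X_pow, hj.ne, coeff_one, coeff_X_mul]

theorem degree_negacyclicShift_lt {n : ℕ} (hn : n ≠ 0) {w : ℤ[X]} (hw : w.natDegree < n) :
    (negacyclicShift n w).degree < (n : WithBot ℕ) := by
  rw [degree_lt_iff_coeff_zero]
  intro m hm
  obtain ⟨k, rfl⟩ := Nat.exists_eq_succ_of_ne_zero (by omega : m ≠ 0)
  rcases hm.eq_or_lt with h | h
  · subst h
    simp [negacyclicShift, coeff_one, coeff_X_mul]
  · have h1 : w.coeff k = 0 := coeff_eq_zero_of_natDegree_lt (by omega)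
    simp [negacyclicShift, coeff_X_pow, coeff_one, coeff_X_mul, h1, h.ne']

theorem dvd_coeff_of_dvd_negacyclicShift_sub {n i : ℕ} {w : ℤ[X]} {d r g : ℤ}
    (h : ∀ j < n, d ∣ (negacyclicShift n w).coeff j - r * w.coeff j) (hgd : g ∣ d) (hi : i < n)
    (hg : g ∣ w.coeff i) {k : ℕ} (hk : k < n) : g ∣ w.coeff k := by
  have hshift : ∀ j < n, g ∣ w.coeff j → g ∣ (negacyclicShift n w).coeff j := fun j hj hgj =>
    (dvd_sub_left (hgj.mul_left r)).1 (hgd.trans (h j hj))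
  have hdown : ∀ j < n, g ∣ w.coeff j → ∀ l ≤ j, g ∣ w.coeff l := by
    intro j
    induction j with
    | zero =>
      intro _ hgj l hl
      rwa [Nat.le_zero.1 hl]
    | succ j ih =>
      intro hj hgj l hl
      rcases hl.eq_or_lt with rfl | hl
      · exact hgj
      · refine ih (by omega) ?_ l (by omega)
        rw [← coeff_succ_negacyclicShift hj]
        exact hshift _ hj hgj
  refine hdown (n - 1) (by omega) ?_ k (by omega)
  rw [← dvd_neg, ← coeff_zero_negacyclicShift (by omega)]
  exact hshift 0 (by omega) (hdown i hi hg 0 (by omega))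

theorem dvd_minor_negacyclicShift {n : ℕ} {v w : ℤ[X]} (hd0 : resultantZ v (X ^ n + 1) ≠ 0)
    (hw : w.natDegree < n)
    (hvw : (X : ℤ[X]) ^ n + 1 ∣ v * w - C (resultantZ v (X ^ n + 1))) {i j : ℕ}
    (hi : i < n) (hj : j < n) :
    resultantZ v (X ^ n + 1) ∣ w.coeff i * (negacyclicShift n w).coeff j -
      w.coeff j * (negacyclicShift n w).coeff i := by
  rcases eq_or_ne i j with rfl | hij
  · simp
  have hn2 : 2 ≤ n := by omega
  have hf : ((X : ℤ[X]) ^ n + 1).Monic := monic_X_pow_add_C 1 (by omega)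
  have hfn : ((X : ℤ[X]) ^ n + 1).natDegree = n := natDegree_X_pow_add_C (r := 1)
  have hfd : ((X : ℤ[X]) ^ n + 1).degree = n := by rw [degree_eq_natDegree hf.ne_zero, hfn]
  obtain ⟨t, ht⟩ := hvw
  have key : ∀ (s t p : ℤ[X]), s.degree < (n : WithBot ℕ) → p.degree < (2 : ℕ) →
      s * v + t * (X ^ n + 1) = C (resultantZ v (X ^ n + 1)) * p →
      ∃ (c : Fin (((X : ℤ[X]) ^ n + 1).natDegree + v.natDegree) → ℤ),
        (∀ i : Fin _, (i : ℕ) < n → c i = s.coeff i) ∧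
        c ᵥ* sylvesterMatrix v (X ^ n + 1) =
          (sylvesterMatrix v (X ^ n + 1)).det • fun j : Fin _ => p.coeff j := by
    intro s t p hs hp h
    obtain ⟨c, hc, hcS⟩ := exists_vecMul_sylvesterMatrix (a := v) (t := t) hf (hs.trans_eq hfd.symm) (by
      rw [h, degree_C_mul hd0]
      refine hp.trans_le ?_
      rw [hfn]
      norm_cast
      omega)
    refine ⟨c, fun i hi => hc i (hi.trans_eq hfn.symm), ?_⟩
    rw [hcS, h]
    ext j
    simp [resultantZ]
  obtain ⟨a, ha, haS⟩ := key w (-t) 1 (degree_le_natDegree.trans_lt (by exact_mod_cast hw))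
    (by rw [degree_one]; norm_num) (by linear_combination ht)
  obtain ⟨b, hb, hbS⟩ := key (negacyclicShift n w) (C (w.coeff (n - 1)) * v - X * t) X
    (degree_negacyclicShift_lt (by omega) hw) (by rw [degree_X]; norm_num)
    (by rw [negacyclicShift]; linear_combination X * ht)
  have hlt : ∀ k < n, k < ((X : ℤ[X]) ^ n + 1).natDegree + v.natDegree := by
    intro k hk
    omega
  have := det_dvd_minor (sylvesterMatrix v (X ^ n + 1)) hd0 haS hbS
    (i := ⟨i, hlt i hi⟩) (j := ⟨j, hlt j hj⟩) (by simpa using hij)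
  rwa [ha ⟨i, hlt i hi⟩ hi, ha ⟨j, hlt j hj⟩ hj, hb ⟨i, hlt i hi⟩ hi, hb ⟨j, hlt j hj⟩ hj] at this

theorem exists_X_sub_C_mem_of_coprime {n : ℕ} {v w : ℤ[X]}
    (hd0 : resultantZ v (X ^ n + 1) ≠ 0) (hw : w.natDegree < n)
    (hvw : (X : ℤ[X]) ^ n + 1 ∣ v * w - C (resultantZ v (X ^ n + 1))) {i : ℕ} (hi : i < n)
    (hcop : IsCoprime (w.coeff i) (resultantZ v (X ^ n + 1))) :
    ∃ (r : ℤ) (s : ℤ[X]), (X : ℤ[X]) ^ n + 1 ∣ X - C r - s * v := by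
  have hminor := fun j (hj : j < n) => dvd_minor_negacyclicShift hd0 hw hvw hi hj
  set d := resultantZ v (X ^ n + 1)
  obtain ⟨y, z, hyz⟩ := hcop
  have hdvd : C d ∣ negacyclicShift n w - C (y * (negacyclicShift n w).coeff i) * w := by
    rw [C_dvd_iff_dvd_coeff]
    intro j
    rw [coeff_sub, coeff_C_mul]
    by_cases hj : j < n
    · obtain ⟨e, he⟩ := hminor j hj
      exact ⟨y * e + z * (negacyclicShift n w).coeff j,
        by linear_combination y * he - (negacyclicShift n w).coeff j * hyz⟩
    · rw [(degree_lt_iff_coeff_zero _ _).1 (degree_negacyclicShift_lt (by omega) hw) _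
        (not_lt.1 hj), coeff_eq_zero_of_natDegree_lt (by omega : w.natDegree < j)]
      simp
  obtain ⟨s, hs⟩ := hdvd
  obtain ⟨t, ht⟩ := hvw
  refine ⟨y * (negacyclicShift n w).coeff i, s, (monic_X_pow_add_C 1 (by omega : n ≠ 0)).dvd_of_dvd_C_mul hd0
    ⟨C (w.coeff (n - 1)) * v - (X - C (y * (negacyclicShift n w).coeff i)) * t, ?_⟩⟩
  rw [C_1]
  rw [negacyclicShift] at hs ⊢
  linear_combination v * hs - (X - C (y * (X * w - C (w.coeff (n - 1)) * (X ^ n + 1)).coeff i)) * ht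

theorem gcd_coeff_eq_one_of_X_sub_C_mem {n : ℕ} {v w : ℤ[X]}
    (hd0 : resultantZ v (X ^ n + 1) ≠ 0) (hw : w.natDegree < n)
    (hvw : (X : ℤ[X]) ^ n + 1 ∣ v * w - C (resultantZ v (X ^ n + 1)))
    {r : ℤ} {s : ℤ[X]} (hr : (X : ℤ[X]) ^ n + 1 ∣ X - C r - s * v) {i : ℕ} (hi : i < n) :
    Int.gcd (w.coeff i) (resultantZ v (X ^ n + 1)) = 1 := by
  have hn : n ≠ 0 := by omega
  have hf : ((X : ℤ[X]) ^ n + 1).Monic := monic_X_pow_add_C 1 hn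
  have hfn : ((X : ℤ[X]) ^ n + 1).natDegree = n := natDegree_X_pow_add_C (r := 1)
  have hfd : ((X : ℤ[X]) ^ n + 1).degree = n := by rw [degree_eq_natDegree hf.ne_zero, hfn]
  have hres : ∀ m : ℤ, C m ∈ Ideal.span {v, (X : ℤ[X]) ^ n + 1} →
      resultantZ v (X ^ n + 1) ∣ m := fun m => by
    refine resultantZ_dvd_of_mem_span hf (by omega) (r := r) ?_
    obtain ⟨t, ht⟩ := hr
    exact Ideal.mem_span_pair.2 ⟨s, t, by linear_combination -ht⟩
  set d := resultantZ v (X ^ n + 1)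
  have hcoeff : ∀ j < n, d ∣ (negacyclicShift n w).coeff j - r * w.coeff j := by
    intro j _
    rw [← coeff_C_mul, ← coeff_sub]
    revert j
    suffices C d ∣ negacyclicShift n w - C r * w from
      fun j _ => (C_dvd_iff_dvd_coeff _ _).1 this j
    have hwd : w.degree < (n : WithBot ℕ) := degree_le_natDegree.trans_lt (by exact_mod_cast hw)
    have hlt : (negacyclicShift n w - C r * w).degree < ((X : ℤ[X]) ^ n + 1).degree := by
      rw [hfd]
      refine (degree_sub_le _ _).trans_lt (max_lt (degree_negacyclicShift_lt hn hw) ?_)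
      rw [← smul_eq_C_mul]
      exact (degree_smul_le _ _).trans_lt hwd
    have hmod : (negacyclicShift n w - C r * w) %ₘ (X ^ n + 1) = (d • s) %ₘ (X ^ n + 1) := by
      rw [← sub_eq_zero, ← sub_modByMonic, modByMonic_eq_zero_iff_dvd hf]
      obtain ⟨t, ht⟩ := hr
      obtain ⟨k, hk⟩ := hvw
      refine ⟨t * w - C (w.coeff (n - 1)) + s * k, ?_⟩
      rw [negacyclicShift, smul_eq_C_mul]
      linear_combination w * ht + s * hk
    rw [(modByMonic_eq_self_iff hf).2 hlt, smul_modByMonic, smul_eq_C_mul] at hmod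
    exact ⟨_, hmod⟩
  set g : ℤ := (Int.gcd (w.coeff i) d : ℤ)
  have hgd : g ∣ d := Int.gcd_dvd_right ..
  have hgw : C g ∣ w := by
    rw [C_dvd_iff_dvd_coeff]
    intro k
    by_cases hk : k < n
    · exact dvd_coeff_of_dvd_negacyclicShift_sub hcoeff hgd hi (Int.gcd_dvd_left ..) hk
    · rw [coeff_eq_zero_of_natDegree_lt (by omega : w.natDegree < k)]
      exact dvd_zero _
  obtain ⟨w', hw'⟩ := hgw
  obtain ⟨d', hd'⟩ := hgd
  have hg0 : g ≠ 0 := by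
    intro h
    rw [h, zero_mul] at hd'
    exact hd0 hd'
  obtain ⟨k, hk⟩ : (X : ℤ[X]) ^ n + 1 ∣ v * w' - C d' := by
    refine hf.dvd_of_dvd_C_mul hg0 ?_
    convert hvw using 1
    rw [hd', C_mul, hw']
    ring
  obtain ⟨e, he⟩ := hres d' (Ideal.mem_span_pair.2 ⟨w', -k, by linear_combination hk⟩)
  have hge : g * e = 1 := mul_left_cancel₀ hd0 (by linear_combination -hd' - g * he)
  simpa [g] using Int.isUnit_iff_natAbs_eq.1 (IsUnit.of_mul_eq_one _ hge)

/-- Let `n` be a power of 2, `f = x^n+1`, `v ∈ ℤ[x]` of degree `< n`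
with `d = Res(v,f) ≠ 0`, and `w` the polynomial of degree `< n` with
`v·w ≡ d (mod x^n+1)`. Then the following are equivalent:
(i) some `x − r` (`r ∈ ℤ`) lies in the ideal `I` generated by `v` in `ℤ[x]/(x^n+1)`;
(ii) `gcd(w_i, d) = 1` for some `0 ≤ i ≤ n−1`;
(iii) `gcd(w_i, d) = 1` for every `0 ≤ i ≤ n−1`. -/
theorem simpleHNF_tfae
    (n : ℕ) (hn : ∃ k : ℕ, n = 2 ^ k)
    (v : Polynomial ℤ) (hv : v.natDegree < n)
    (d : ℤ) (hd : d = resultantZ v (X ^ n + 1)) (hd0 : d ≠ 0)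
    (w : Polynomial ℤ) (hw : w.natDegree < n)
    (hvw : ((X : Polynomial ℤ) ^ n + 1) ∣ v * w - C d) :
    [ (∃ r : ℤ, Ideal.Quotient.mk (Ideal.span {(X : Polynomial ℤ) ^ n + 1}) (X - C r) ∈
        Ideal.span {Ideal.Quotient.mk (Ideal.span {(X : Polynomial ℤ) ^ n + 1}) v}),
      (∃ i : ℕ, i < n ∧ Int.gcd (w.coeff i) d = 1),
      (∀ i : ℕ, i < n → Int.gcd (w.coeff i) d = 1) ].TFAE := by
  subst hd
  simp only [mk_mem_span_mk_iff]
  tfae_have 1 → 3 := by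
    rintro ⟨r, s, hr⟩ i hi
    exact gcd_coeff_eq_one_of_X_sub_C_mem hd0 hw hvw hr hi
  tfae_have 3 → 2 := fun h => ⟨0, by omega, h 0 (by omega)⟩
  tfae_have 2 → 1 := by
    rintro ⟨i, hi, hcop⟩
    exact exists_X_sub_C_mem_of_coprime hd0 hw hvw hi (Int.isCoprime_iff_gcd_eq_one.2 hcop)
  tfae_finish
end

section
/- Let n be a power of 2, f = x^n + 1, and v ∈ ℤ[x] of degree < n with d = Res(v,f) ≠ 0. Let w = w_0 + w_1x + ⋯ + w_{n−1}x^{n−1} ∈ ℤ[x] be the polynomial of degree < n with v(x)·w(x) ≡ d (mod x^n + 1). If there exists an index i with 0 ≤ i ≤ n−1 such that gcd(w_i, d) = 1, then gcd(w_j, d) = 1 for every index j with 0 ≤ j ≤ n−1. -/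
open Polynomial Matrix

/-- A row of coefficients of `a` (below `deg f`) and `b` (below `deg v`) multiplied by the Sylvester
matrix of `v` and `f` gives the coefficients of `a * v + b * f`. -/
theorem vecMul_sylvesterMatrix (v f a b : ℤ[X]) (ha : a.degree < f.natDegree)
    (hb : b.degree < v.natDegree) (j : Fin (f.natDegree + v.natDegree)) :
    ((fun i : Fin (f.natDegree + v.natDegree) =>
      if (i : ℕ) < f.natDegree then a.coeff i else b.coeff (i - f.natDegree)) ᵥ*
        sylvesterMatrix v f) j = (a * v + b * f).coeff j := by
  have coeff_mul_eq_sum : ∀ (p q : ℤ[X]) (N k : ℕ), p.degree < N →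
      (p * q).coeff k = ∑ i : Fin N, p.coeff i * if (i : ℕ) ≤ k then q.coeff (k - i) else 0 := by
    intro p q N k hp
    conv_lhs => rw [← Polynomial.sum_monomial_eq p, Polynomial.sum_eq_of_subset
      (s := Finset.range N) _ (by simp) (fun i hi => Finset.mem_range.2 (by
        by_contra h
        exact (mem_support_iff.1 hi) (coeff_eq_zero_of_degree_lt
          (hp.trans_le (by exact_mod_cast not_lt.1 h)))))]
    rw [Finset.sum_mul, finsetSum_coeff, ← Fin.sum_univ_eq_sum_range
      (fun i => (monomial i (p.coeff i) * q).coeff k) N]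
    refine Finset.sum_congr rfl fun i _ => ?_
    rw [← C_mul_X_pow_eq_monomial, mul_assoc, coeff_C_mul, coeff_X_pow_mul']
  rw [coeff_add, coeff_mul_eq_sum a v _ j ha, coeff_mul_eq_sum b f _ j hb]
  simp [vecMul, dotProduct, Fin.sum_univ_add, sylvesterMatrix, add_comm, -Fin.val_fin_le]

/-- A congruence `v * a ≡ r` modulo a monic `f` yields a row vector extending the coefficients of
`a` that the Sylvester matrix maps to the coefficients of `r`. -/
theorem exists_vecMul_sylvesterMatrix_s12 {v f a r : ℤ[X]} (hf : f.Monic)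
    (ha : a.degree < f.natDegree) (hr : r.degree < f.natDegree) (h : f ∣ v * a - r) :
    ∃ y : Fin (f.natDegree + v.natDegree) → ℤ,
      (∀ i : Fin (f.natDegree + v.natDegree), (i : ℕ) < f.natDegree → y i = a.coeff i) ∧
        y ᵥ* sylvesterMatrix v f = fun j : Fin (f.natDegree + v.natDegree) => r.coeff j := by
  obtain ⟨b, hb⟩ := h
  have hdeg : (f * b).degree < ((f.natDegree + v.natDegree : ℕ) : WithBot ℕ) := by
    rw [← hb, degree_lt_iff_coeff_zero]
    intro k hk
    have hr0 : r.coeff k = 0 := (degree_lt_iff_coeff_zero _ _).1 hr k (by omega)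
    rw [coeff_sub, hr0, sub_zero]
    by_cases ha0 : a = 0
    · simp [ha0]
    · apply coeff_eq_zero_of_natDegree_lt
      have := (natDegree_lt_iff_degree_lt ha0).2 ha
      have := natDegree_mul_le (p := v) (q := a)
      omega
  have hbdeg : (-b).degree < v.natDegree := by
    rw [degree_neg]
    by_cases hb0 : b = 0
    · simp [hb0]
    · have hfb : f * b ≠ 0 := mul_ne_zero hf.ne_zero hb0
      rw [← natDegree_lt_iff_degree_lt hfb, natDegree_mul hf.ne_zero hb0] at hdeg
      rw [← natDegree_lt_iff_degree_lt hb0]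
      omega
  refine ⟨fun i => if (i : ℕ) < f.natDegree then a.coeff i else (-b).coeff (i - f.natDegree),
    fun i hi => if_pos hi, funext fun j => ?_⟩
  rw [vecMul_sylvesterMatrix v f a (-b) ha hbdeg j]
  congr 1
  linear_combination hb

/-- If `u` and `z` solve `u A = det A • e_k` and `z A = det A • e_k'`, then the `2 × 2` minors
involving an entry of `u` coprime to `det A` vanish modulo `det A`. -/
theorem det_dvd_minor_of_vecMul_eq {ι R : Type*} [Fintype ι] [DecidableEq ι] [CommRing R]
    [IsDomain R] {A : Matrix ι ι R} (hA : A.det ≠ 0) {u z : ι → R} {k k' l : ι}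
    (hu : u ᵥ* A = A.det • Pi.single k 1) (hz : z ᵥ* A = A.det • Pi.single k' 1)
    (hl : IsCoprime (u l) A.det) (j : ι) : A.det ∣ z l * u j - u l * z j := by
  have hadj : A.adjugate k l = u l := by
    have h := congrFun (congrArg (· ᵥ* A.adjugate) hu) l
    simp only [vecMul_vecMul, mul_adjugate, vecMul_smul, vecMul_one, smul_vecMul,
      single_one_vecMul, Pi.smul_apply, smul_eq_mul, row_apply] at h
    exact (mul_left_cancel₀ hA h).symm
  set B := A.updateRow l (Pi.single k 1) with hB
  have hdet : B.det = u l := by rw [← hadj, adjugate_apply]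
  set y : ι → R := z l • u - u l • z with hy
  have hyl : y l = 0 := by simp [hy, mul_comm]
  have hyB : y ᵥ* B = A.det • (z l • Pi.single k 1 - u l • Pi.single k' 1) := by
    have hAB : y ᵥ* B = y ᵥ* A := by
      funext c
      refine Finset.sum_congr rfl fun i _ => ?_
      by_cases hi : i = l
      · simp [hi, hyl]
      · simp [hB, hi]
    rw [hAB, hy, sub_vecMul, smul_vecMul, smul_vecMul, hu, hz, smul_sub, smul_comm (z l),
      smul_comm (u l)]
  have h := congrFun (congrArg (· ᵥ* B.adjugate) hyB) j
  simp only [vecMul_vecMul, mul_adjugate, vecMul_smul, vecMul_one, smul_vecMul, Pi.smul_apply,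
    smul_eq_mul, hdet] at h
  exact hl.symm.dvd_of_dvd_mul_left ⟨_, h⟩

/-- Let `n` be a power of 2, `f = x^n+1`, `v ∈ ℤ[x]` of degree `< n`
with `d = Res(v,f) ≠ 0`, and `w` the polynomial of degree `< n` with
`v·w ≡ d (mod x^n+1)`. If `gcd(w_i, d) = 1` for some index `0 ≤ i ≤ n−1`, then
`gcd(w_j, d) = 1` for every index `0 ≤ j ≤ n−1`. -/
theorem all_coeff_coprime_of_exists
    (n : ℕ) (hn : ∃ k : ℕ, n = 2 ^ k)
    (v : Polynomial ℤ) (hv : v.natDegree < n)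
    (d : ℤ) (hd : d = resultantZ v (X ^ n + 1)) (hd0 : d ≠ 0)
    (w : Polynomial ℤ) (hw : w.natDegree < n)
    (hvw : ((X : Polynomial ℤ) ^ n + 1) ∣ v * w - C d)
    (hex : ∃ i : ℕ, i < n ∧ Int.gcd (w.coeff i) d = 1) :
    ∀ j : ℕ, j < n → Int.gcd (w.coeff j) d = 1 := by
  intro j hj
  obtain ⟨l, hl, hwl⟩ := hex
  obtain rfl | hn2 : n = 1 ∨ 2 ≤ n := by omega
  · obtain rfl : j = l := by omega
    exact hwl
  have hnd : ((X : ℤ[X]) ^ n + 1).natDegree = n := by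
    simpa using natDegree_X_pow_add_C (n := n) (r := (1 : ℤ))
  have hmonic : ((X : ℤ[X]) ^ n + 1).Monic := by
    simpa using monic_X_pow_add_C (1 : ℤ) (by omega : n ≠ 0)
  have hwcoeff : ∀ k, n ≤ k → w.coeff k = 0 := fun k hk =>
    coeff_eq_zero_of_natDegree_lt (by omega)
  set f : ℤ[X] := X ^ n + 1 with hf
  have hdet : (sylvesterMatrix v f).det = d := hd.symm
  set w' : ℤ[X] := X * w - C (w.coeff (n - 1)) * f with hw'
  have hw'0 : w'.coeff 0 = -w.coeff (n - 1) := by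
    simp [hw', hf, coeff_X_pow, show 0 ≠ n by omega]
  have hw'succ : ∀ k, k + 1 < n → w'.coeff (k + 1) = w.coeff k := by
    intro k hk
    simp [hw', hf, coeff_X_mul, coeff_X_pow, coeff_one, hk.ne]
  obtain ⟨u, hu, huS⟩ := exists_vecMul_sylvesterMatrix_s12 (v := v) (f := f) (a := w) (r := C d) hmonic
    (by rw [hnd, degree_lt_iff_coeff_zero]; exact hwcoeff)
    (by rw [hnd, degree_lt_iff_coeff_zero]; exact fun k hk => coeff_C_of_ne_zero (by omega)) hvw
  obtain ⟨z, hz, hzS⟩ := exists_vecMul_sylvesterMatrix_s12 (v := v) (f := f) (a := w') (r := C d * X)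
    hmonic
    (by
      rw [hnd, degree_lt_iff_coeff_zero]
      rintro (_ | k) hk
      · omega
      · obtain hk' | hk' := hk.eq_or_lt
        · simp [hw', hf, coeff_X_mul, coeff_X_pow, coeff_one, hk']
        · simp [hw', hf, coeff_X_mul, coeff_X_pow, coeff_one, hk'.ne', hwcoeff k (by omega)])
    (by
      rw [hnd, degree_lt_iff_coeff_zero]
      intro k hk
      simp [coeff_X, show 1 ≠ k by omega])
    (by
      have : v * w' - C d * X = X * (v * w - C d) - f * (C (w.coeff (n - 1)) * v) := by
        rw [hw']; ring
      rw [this]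
      exact dvd_sub (hvw.mul_left _) (dvd_mul_right _ _))
  let idx (k : ℕ) (hk : k < n) : Fin (f.natDegree + v.natDegree) := ⟨k, by omega⟩
  have hminor := det_dvd_minor_of_vecMul_eq (A := sylvesterMatrix v f) (u := u) (z := z)
    (k := idx 0 (by omega)) (k' := idx 1 (by omega)) (l := idx l hl) (by rwa [hdet])
    (by
      rw [huS, hdet]
      funext c
      simp [coeff_C, Pi.single_apply, idx, Fin.ext_iff, -eq_intCast])
    (by
      rw [hzS, hdet]
      funext c
      simp [coeff_X, Pi.single_apply, idx, Fin.ext_iff, eq_comm])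
    (by
      rw [hdet, hu _ (by simpa [idx, hnd] using hl)]
      exact Int.isCoprime_iff_gcd_eq_one.2 hwl)
  rw [hdet] at hminor
  by_contra hgcd
  obtain ⟨p, hp, hpg⟩ := Nat.exists_prime_and_dvd hgcd
  have hpZ : Prime (p : ℤ) := Nat.prime_iff_prime_int.1 hp
  have hpj : (p : ℤ) ∣ w.coeff j := (Int.natCast_dvd_natCast.2 hpg).trans (Int.gcd_dvd_left ..)
  have hpd : (p : ℤ) ∣ d := (Int.natCast_dvd_natCast.2 hpg).trans (Int.gcd_dvd_right ..)
  have hpl : ¬ (p : ℤ) ∣ w.coeff l := fun h => hp.one_lt.ne' <| Nat.dvd_one.1 <| by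
    rw [← hwl]
    exact_mod_cast Int.dvd_coe_gcd h hpd
  have hstep : ∀ k, k < n → (p : ℤ) ∣ w.coeff k → (p : ℤ) ∣ w'.coeff k := by
    intro k hk hpk
    have h := hpd.trans (hminor (idx k hk))
    rw [hu (idx k hk) (hk.trans_eq hnd.symm), hu (idx l hl) (hl.trans_eq hnd.symm),
      hz (idx k hk) (hk.trans_eq hnd.symm)] at h
    exact (hpZ.dvd_or_dvd ((dvd_sub_right (hpk.mul_left _)).1 h)).resolve_left hpl
  have hdown : ∀ t k, t + k < n → (p : ℤ) ∣ w.coeff (t + k) → (p : ℤ) ∣ w.coeff k := by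
    intro t k
    induction t with
    | zero => simp
    | succ t ih =>
      intro ht h
      have e : t + 1 + k = (t + k) + 1 := by omega
      rw [e] at ht h
      exact ih (by omega) (hw'succ _ ht ▸ hstep _ ht h)
  have hlast : (p : ℤ) ∣ w.coeff (n - 1) := by
    have h := hstep 0 (by omega) (hdown j 0 (by omega) hpj)
    rwa [hw'0, dvd_neg] at h
  have e : n - 1 - l + l = n - 1 := by omega
  exact hpl (hdown (n - 1 - l) l (by omega) (e.symm ▸ hlast))
end

section
/- Let n be a power of 2, f = x^n + 1, and v ∈ ℤ[x] of degree < n with d = Res(v,f) ≠ 0. Let w = w_0 + w_1x + ⋯ + w_{n−1}x^{n−1} ∈ ℤ[x] be the polynomial of degree < n with v(x)·w(x) ≡ d (mod x^n + 1). If gcd(w_i, d) = 1 for every index i with 0 ≤ i ≤ n−1, then there exists r ∈ ℤ such that x − r lies in the ideal I generated by v in ℤ[x]/(x^n+1). -/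
open Polynomial Matrix

/-- If a quotient of a finite free `ℤ`-module has cardinality `|d|` and the class of `u` has order
divisible by `d`, then the class of `u` generates the quotient. -/
theorem Submodule.exists_sub_smul_mem_of_card_quotient {M : Type*} [AddCommGroup M]
    (L : Submodule ℤ M) (d : ℤ) (hd : d ≠ 0) (hcard : Nat.card (M ⧸ L) = d.natAbs) (u : M)
    (hu : ∀ k : ℤ, k • u ∈ L → d ∣ k) (y : M) : ∃ r : ℤ, y - r • u ∈ L := by
  have : Finite (M ⧸ L) := Nat.finite_of_card_ne_zero (by simpa [hcard] using hd)
  have hdvd : d.natAbs ∣ addOrderOf (L.mkQ u) := by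
    have h : d ∣ (addOrderOf (L.mkQ u) : ℤ) := hu _ <| by
      rw [← Submodule.Quotient.mk_eq_zero, ← Submodule.mkQ_apply, map_smul, natCast_zsmul,
        addOrderOf_nsmul_eq_zero]
    exact Int.natAbs_dvd_natAbs.mpr h
  have htop : AddSubgroup.zmultiples (L.mkQ u) = ⊤ := by
    apply AddSubgroup.eq_top_of_le_card
    rw [hcard, Nat.card_zmultiples]
    exact Nat.le_of_dvd (addOrderOf_pos _) hdvd
  obtain ⟨r, hr⟩ := AddSubgroup.mem_zmultiples_iff.mp (htop ▸ AddSubgroup.mem_top (L.mkQ y))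
  refine ⟨r, ?_⟩
  rw [← Submodule.Quotient.mk_eq_zero, ← Submodule.mkQ_apply, map_sub, map_smul, hr, sub_self]

theorem LinearMap.card_quotient_range_eq_natAbs_det {M : Type*} [AddCommGroup M]
    [Module.Free ℤ M] [Module.Finite ℤ M] (g : M →ₗ[ℤ] M) (hg : LinearMap.det g ≠ 0) :
    Nat.card (M ⧸ LinearMap.range g) = (LinearMap.det g).natAbs := by
  have hinj : Function.Injective g := by
    rw [← LinearMap.ker_eq_bot]
    exact not_not.mp (mt LinearMap.det_eq_zero_iff_ker_ne_bot.mpr hg)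
  exact (Submodule.natAbs_det_equiv (LinearMap.range g) (LinearEquiv.ofInjective g hinj)).symm

theorem sum_sylvesterMatrix_mem_span (a b : ℤ[X]) (i : Fin (b.natDegree + a.natDegree)) :
    ∑ j, C (sylvesterMatrix a b i j) * X ^ (j : ℕ) ∈ Ideal.span {a, b} := by
  have shift (p : ℤ[X]) (s : ℕ) (h : s + p.natDegree < b.natDegree + a.natDegree) :
      ∑ j : Fin (b.natDegree + a.natDegree),
        C (if s ≤ (j : ℕ) then p.coeff (j - s) else 0) * X ^ (j : ℕ) = p * X ^ s := by
    have hp := (p * X ^ s).as_sum_range_C_mul_X_pow' (n := b.natDegree + a.natDegree)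
      (natDegree_mul_le.trans_lt (by rw [natDegree_X_pow]; omega))
    simp only [coeff_mul_X_pow'] at hp
    rw [hp, Fin.sum_univ_eq_sum_range
      (fun j => C (if s ≤ j then p.coeff (j - s) else 0) * (X : ℤ[X]) ^ j)]
  have hi := i.isLt
  by_cases h : (i : ℕ) < b.natDegree
  · simp only [sylvesterMatrix, of_apply, if_pos h]
    rw [shift a i (by omega)]
    exact Ideal.mul_mem_right _ _ (Ideal.subset_span (by simp))
  · simp only [sylvesterMatrix, of_apply, if_neg h]
    rw [shift b (i - b.natDegree) (by omega)]
    exact Ideal.mul_mem_right _ _ (Ideal.subset_span (by simp))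

theorem sum_vecMul_sylvesterMatrix_mem_span (a b : ℤ[X])
    (c : Fin (b.natDegree + a.natDegree) → ℤ) :
    ∑ j, C ((c ᵥ* sylvesterMatrix a b) j) * X ^ (j : ℕ) ∈ Ideal.span {a, b} := by
  have h : ∑ j, C ((c ᵥ* sylvesterMatrix a b) j) * X ^ (j : ℕ) =
      ∑ i, C (c i) * ∑ j, C (sylvesterMatrix a b i j) * X ^ (j : ℕ) := by
    simp only [vecMul, dotProduct, map_sum, map_mul, Finset.sum_mul, Finset.mul_sum, mul_assoc]
    exact Finset.sum_comm
  rw [h]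
  exact Ideal.sum_mem _ fun i _ => Ideal.mul_mem_left _ _ (sum_sylvesterMatrix_mem_span a b i)

/-- If the only integers in the ideal `(a, b)` are multiples of the nonzero resultant of `a` and
`b`, then `(a, b)` contains a monic linear polynomial. -/
theorem exists_X_sub_C_mem_span_of_resultantZ_dvd (a b : ℤ[X])
    (hdeg : 2 ≤ b.natDegree + a.natDegree) (hres : resultantZ a b ≠ 0)
    (h : ∀ k : ℤ, C k ∈ Ideal.span {a, b} → resultantZ a b ∣ k) :
    ∃ r : ℤ, X - C r ∈ Ideal.span {a, b} := by
  let g := (sylvesterMatrix a b).vecMulLinear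
  have hdet : LinearMap.det g = resultantZ a b := by
    have : g = Matrix.toLin' (sylvesterMatrix a b)ᵀ := by
      ext1 j
      ext
      simp [g]
    rw [this, LinearMap.det_toLin', det_transpose, resultantZ]
  have hmem (y) (hy : y ∈ LinearMap.range g) :
      ∑ j, C (y j) * X ^ (j : ℕ) ∈ Ideal.span {a, b} := by
    obtain ⟨c, rfl⟩ := hy
    exact sum_vecMul_sylvesterMatrix_mem_span a b c
  have hsingle (i : Fin (b.natDegree + a.natDegree)) :
      ∑ j, C ((Pi.single i 1 : Fin (b.natDegree + a.natDegree) → ℤ) j) * (X : ℤ[X]) ^ (j : ℕ) =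
        X ^ (i : ℕ) := by
    simp [Pi.single_apply, apply_ite C, ite_mul]
  obtain ⟨r, hr⟩ := (LinearMap.range g).exists_sub_smul_mem_of_card_quotient (resultantZ a b) hres
    (by rw [LinearMap.card_quotient_range_eq_natAbs_det g (hdet ▸ hres), hdet])
    (Pi.single ⟨0, by omega⟩ 1)
    (fun k hk => h k <| by
      have := hmem _ hk
      simp only [Pi.smul_apply, smul_eq_mul, map_mul, mul_assoc, ← Finset.mul_sum,
        hsingle] at this
      simpa using this)
    (Pi.single ⟨1, by omega⟩ 1)
  refine ⟨r, ?_⟩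
  have := hmem _ hr
  simp only [Pi.sub_apply, Pi.smul_apply, smul_eq_mul, map_mul, map_sub, mul_assoc, sub_mul,
    Finset.sum_sub_distrib, ← Finset.mul_sum, hsingle] at this
  simpa using this

/-- If `v * w ≡ d` modulo a monic `f` and some coefficient of `w` is coprime to `d`, then every
integer in the ideal `(v, f)` is a multiple of `d`. -/
theorem dvd_of_C_mem_span_of_dvd_mul_sub_C {v f w : ℤ[X]} (hf : f.Monic) {d : ℤ}
    (hw : w.degree < f.degree) (hvw : f ∣ v * w - C d) {i : ℕ} (hi : IsCoprime d (w.coeff i))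
    {k : ℤ} (hk : C k ∈ Ideal.span {v, f}) : d ∣ k := by
  obtain ⟨p, q, hpq⟩ := Ideal.mem_span_pair.mp hk
  have hdvd : f ∣ C k * w - C d * (p %ₘ f) := by
    obtain ⟨t, ht⟩ := hvw
    refine ⟨p * t + q * w + C d * (p /ₘ f), ?_⟩
    linear_combination (-w) * hpq + p * ht - C d * (modByMonic_add_div p f)
  have hzero : C k * w - C d * (p %ₘ f) = 0 := by
    refine eq_zero_of_dvd_of_degree_lt hdvd ((degree_sub_le _ _).trans_lt (max_lt ?_ ?_))
    · exact (C_mul' (R := ℤ) _ _ ▸ degree_smul_le _ _).trans_lt hw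
    · exact (C_mul' (R := ℤ) _ _ ▸ degree_smul_le _ _).trans_lt (degree_modByMonic_lt p hf)
  have hcoeff : k * w.coeff i = d * (p %ₘ f).coeff i := by
    simpa [sub_eq_zero] using congrArg (coeff · i) hzero
  exact hi.dvd_of_dvd_mul_right ⟨_, hcoeff⟩

/-- Let `n` be a power of 2, `f = x^n+1`, `v ∈ ℤ[x]` of degree `< n`
with `d = Res(v,f) ≠ 0`, and `w` the polynomial of degree `< n` with
`v·w ≡ d (mod x^n+1)`. If `gcd(w_i, d) = 1` for every index `0 ≤ i ≤ n−1`, then there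
exists `r ∈ ℤ` such that `x − r` lies in the ideal `I` generated by `v` in
`ℤ[x]/(x^n+1)`. -/
theorem linear_in_ideal_of_all_coeff_coprime
    (n : ℕ) (hn : ∃ k : ℕ, n = 2 ^ k)
    (v : Polynomial ℤ) (hv : v.natDegree < n)
    (d : ℤ) (hd : d = resultantZ v (X ^ n + 1)) (hd0 : d ≠ 0)
    (w : Polynomial ℤ) (hw : w.natDegree < n)
    (hvw : ((X : Polynomial ℤ) ^ n + 1) ∣ v * w - C d)
    (hall : ∀ i : ℕ, i < n → Int.gcd (w.coeff i) d = 1) :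
    ∃ r : ℤ, Ideal.Quotient.mk (Ideal.span {(X : Polynomial ℤ) ^ n + 1}) (X - C r) ∈
      Ideal.span {Ideal.Quotient.mk (Ideal.span {(X : Polynomial ℤ) ^ n + 1}) v} := by
  have hf : ((X : ℤ[X]) ^ n + 1).natDegree = n := natDegree_X_pow_add_C (r := 1)
  have hn0 : n ≠ 0 := by omega
  have hmonic : ((X : ℤ[X]) ^ n + 1).Monic := monic_X_pow_add_C 1 hn0
  suffices h : ∃ r : ℤ, X - C r ∈ Ideal.span {v, (X : ℤ[X]) ^ n + 1} by
    obtain ⟨r, hr⟩ := h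
    obtain ⟨p, q, hpq⟩ := Ideal.mem_span_pair.mp hr
    refine ⟨r, Ideal.mem_span_singleton'.mpr ⟨Ideal.Quotient.mk _ p, ?_⟩⟩
    rw [← map_mul, Ideal.Quotient.eq, Ideal.mem_span_singleton]
    exact ⟨-q, by linear_combination hpq⟩
  obtain rfl | hn1 : n = 1 ∨ 2 ≤ n := by omega
  · exact ⟨-1, Ideal.subset_span (by simp)⟩
  · refine exists_X_sub_C_mem_span_of_resultantZ_dvd v _ (by omega) (hd ▸ hd0) fun k hk => ?_
    rw [← hd]
    refine dvd_of_C_mem_span_of_dvd_mul_sub_C hmonic ?_ hvw (i := 0) ?_ hk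
    · exact degree_lt_degree (by rwa [hf])
    · exact (Int.isCoprime_iff_gcd_eq_one.mpr (hall 0 (by omega))).symm
end

section
/- Let n be a power of 2, f = x^n + 1, and v ∈ ℤ[x] of degree < n with d = Res(v,f) ≠ 0. Let w = w_0 + w_1x + ⋯ + w_{n−1}x^{n−1} ∈ ℤ[x] be the polynomial of degree < n with v(x)·w(x) ≡ d (mod x^n + 1). Suppose r ∈ ℤ is such that x − r lies in the ideal I generated by v in ℤ[x]/(x^n+1). Then r·w_{i+1} ≡ w_i (mod d) for all 0 ≤ i ≤ n−2, and r·w_0 ≡ −w_{n−1} (mod d). -/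
open Polynomial Matrix

/-- If `v * w ≡ d` modulo `f` and `X - r` lies in the ideal generated by `v` modulo `f`,
then `(X - r) * w` is a multiple of `d` modulo `f`. -/
theorem exists_X_sub_C_mul_eq_of_mem_span {f v w : ℤ[X]} {d r : ℤ}
    (hvw : f ∣ v * w - C d)
    (hr : Ideal.Quotient.mk (Ideal.span {f}) (X - C r) ∈
      Ideal.span {Ideal.Quotient.mk (Ideal.span {f}) v}) :
    ∃ q : ℤ[X], f ∣ (X - C r) * w - C d * q := by
  obtain ⟨a, ha⟩ := Ideal.mem_span_singleton.mp hr
  obtain ⟨q, rfl⟩ := Ideal.Quotient.mk_surjective a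
  rw [← map_mul, Ideal.Quotient.eq, Ideal.mem_span_singleton] at ha
  refine ⟨q, ?_⟩
  convert dvd_add (ha.mul_right w) (hvw.mul_left q) using 1
  ring

/-- Let `n` be a power of 2, `f = x^n+1`, `v ∈ ℤ[x]` of degree `< n`
with `d = Res(v,f) ≠ 0`, and `w` the polynomial of degree `< n` with
`v·w ≡ d (mod x^n+1)`. If `r ∈ ℤ` is such that `x − r` lies in the ideal `I` generated
by `v` in `ℤ[x]/(x^n+1)`, then `r·w_{i+1} ≡ w_i (mod d)` for all `0 ≤ i ≤ n−2` and
`r·w_0 ≡ −w_{n−1} (mod d)`. -/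
theorem coeff_recurrence_of_linear_in_ideal
    (n : ℕ) (hn : ∃ k : ℕ, n = 2 ^ k)
    (v : Polynomial ℤ) (hv : v.natDegree < n)
    (d : ℤ) (hd : d = resultantZ v (X ^ n + 1)) (hd0 : d ≠ 0)
    (w : Polynomial ℤ) (hw : w.natDegree < n)
    (hvw : ((X : Polynomial ℤ) ^ n + 1) ∣ v * w - C d)
    (r : ℤ)
    (hr : Ideal.Quotient.mk (Ideal.span {(X : Polynomial ℤ) ^ n + 1}) (X - C r) ∈
      Ideal.span {Ideal.Quotient.mk (Ideal.span {(X : Polynomial ℤ) ^ n + 1}) v}) :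
    (∀ i : ℕ, i + 1 < n → r * w.coeff (i + 1) ≡ w.coeff i [ZMOD d]) ∧
      r * w.coeff 0 ≡ -(w.coeff (n - 1)) [ZMOD d] := by
  have hn0 : n ≠ 0 := by lia
  have hmonic : ((X : ℤ[X]) ^ n + 1).Monic := by simpa using monic_X_pow_add_C (1 : ℤ) hn0
  have hdeg : ((X : ℤ[X]) ^ n + 1).natDegree = n := by
    simpa using natDegree_X_pow_add_C (n := n) (r := (1 : ℤ))
  obtain ⟨q, hq⟩ := exists_X_sub_C_mul_eq_of_mem_span hvw hr
  set q₁ := q %ₘ ((X : ℤ[X]) ^ n + 1)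
  have hq₁deg : q₁.natDegree < n := by
    have h := natDegree_modByMonic_lt q hmonic (fun h => hn0 (by simpa [h] using hdeg.symm))
    rwa [hdeg] at h
  obtain ⟨h, hh⟩ : ((X : ℤ[X]) ^ n + 1) ∣ (X - C r) * w - C d * q₁ := by
    have h₁ : ((X : ℤ[X]) ^ n + 1) ∣ q - q₁ :=
      ⟨q /ₘ ((X : ℤ[X]) ^ n + 1), by
        linear_combination -modByMonic_add_div q ((X : ℤ[X]) ^ n + 1)⟩
    convert dvd_add hq (h₁.mul_left (C d)) using 1
    ring
  have hhdeg : h.natDegree = 0 := by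
    by_cases hz : h = 0
    · simp [hz]
    have h₁ : (((X : ℤ[X]) ^ n + 1) * h).natDegree = n + h.natDegree := by
      rw [hmonic.natDegree_mul' hz, hdeg]
    have h₂ : ((X - C r) * w - C d * q₁).natDegree ≤ n := by
      refine (natDegree_sub_le _ _).trans (max_le ?_ ?_)
      · refine natDegree_mul_le.trans ?_
        rw [natDegree_X_sub_C]
        lia
      · exact (natDegree_C_mul_le _ _).trans hq₁deg.le
    rw [hh, h₁] at h₂
    lia
  obtain ⟨c, rfl⟩ : ∃ c, h = C c := ⟨_, eq_C_of_natDegree_eq_zero hhdeg⟩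
  have hsucc (i : ℕ) : w.coeff i - r * w.coeff (i + 1) - d * q₁.coeff (i + 1) =
      if i + 1 = n then c else 0 := by
    have h₁ := congrArg (fun p : ℤ[X] => p.coeff (i + 1)) hh
    simpa [sub_mul, coeff_X_pow, coeff_one] using h₁
  have hzero : -(r * w.coeff 0) - d * q₁.coeff 0 = c := by
    have h₁ := congrArg (fun p : ℤ[X] => p.coeff 0) hh
    simpa [sub_mul, coeff_X_pow, hn0.symm, hn0] using h₁
  refine ⟨fun i hi => ?_, ?_⟩
  · have h₁ := hsucc i
    rw [if_neg hi.ne] at h₁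
    exact Int.modEq_iff_dvd.mpr ⟨q₁.coeff (i + 1), by linarith⟩
  · have h₁ := hsucc (n - 1)
    rw [Nat.sub_add_cancel (by lia), if_pos rfl, coeff_eq_zero_of_natDegree_lt hw,
      coeff_eq_zero_of_natDegree_lt hq₁deg] at h₁
    exact Int.modEq_iff_dvd.mpr ⟨q₁.coeff 0, by linarith⟩
end

section
/- Let n be a power of 2, f = x^n + 1, and v ∈ ℤ[x] of degree < n with d = Res(v,f) ≠ 0. Let w = w_0 + w_1x + ⋯ + w_{n−1}x^{n−1} ∈ ℤ[x] be the polynomial of degree < n with v(x)·w(x) ≡ d (mod x^n + 1). If a positive integer μ divides every coefficient w_0,…,w_{n−1} of w, then μ divides d and the constant polynomial d/μ lies in the ideal I generated by v in ℤ[x]/(x^n+1). -/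
open Polynomial Matrix

/-- If `C a * p`, with `a ≠ 0`, is congruent to a constant modulo a monic polynomial of positive
degree, then `p` is itself congruent to a constant, and `a` divides the former constant. -/
theorem exists_eq_mul_and_dvd_sub_C_of_monic {R : Type*} [CommRing R] [IsDomain R]
    {f p : R[X]} (hf : f.Monic) (hdeg : 0 < f.degree) {a d : R} (ha : a ≠ 0)
    (h : f ∣ C a * p - C d) : ∃ c, d = a * c ∧ f ∣ p - C c := by
  have hmod : C d = C a * (p %ₘ f) := by
    have h₀ := (modByMonic_eq_zero_iff_dvd hf).2 h
    rw [sub_modByMonic, sub_eq_zero, ← smul_eq_C_mul, smul_modByMonic,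
      (modByMonic_eq_self_iff hf).2 (degree_C_le.trans_lt hdeg), smul_eq_C_mul] at h₀
    exact h₀.symm
  have hd : d = a * (p %ₘ f).coeff 0 := by
    simpa using congrArg (coeff · 0) hmod
  have hconst : C ((p %ₘ f).coeff 0) = p %ₘ f := by
    refine mul_left_cancel₀ (C_ne_zero.2 ha) ?_
    rw [← hmod, ← C_mul, ← hd]
  refine ⟨_, hd, ?_⟩
  rw [hconst, modByMonic_eq_sub_mul_div, sub_sub_cancel]
  exact dvd_mul_right _ _

/-- Let `n` be a power of 2, `f = x^n+1`, `v ∈ ℤ[x]` of degree `< n`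
with `d = Res(v,f) ≠ 0`, and `w` the polynomial of degree `< n` with
`v·w ≡ d (mod x^n+1)`. If a positive integer `μ` divides every coefficient
`w_0,…,w_{n−1}` of `w`, then `μ ∣ d` and the constant polynomial `d/μ` lies in the ideal
`I` generated by `v` in `ℤ[x]/(x^n+1)`. -/
theorem common_divisor_of_coeffs
    (n : ℕ) (hn : ∃ k : ℕ, n = 2 ^ k)
    (v : Polynomial ℤ) (hv : v.natDegree < n)
    (d : ℤ) (hd : d = resultantZ v (X ^ n + 1)) (hd0 : d ≠ 0)
    (w : Polynomial ℤ) (hw : w.natDegree < n)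
    (hvw : ((X : Polynomial ℤ) ^ n + 1) ∣ v * w - C d)
    (μ : ℤ) (hμpos : 0 < μ)
    (hμ : ∀ i : ℕ, i < n → μ ∣ w.coeff i) :
    μ ∣ d ∧
      Ideal.Quotient.mk (Ideal.span {(X : Polynomial ℤ) ^ n + 1}) (C (d / μ)) ∈
        Ideal.span {Ideal.Quotient.mk (Ideal.span {(X : Polynomial ℤ) ^ n + 1}) v} := by
  have hn0 : n ≠ 0 := by omega
  obtain ⟨u, rfl⟩ : C μ ∣ w := by
    refine (C_dvd_iff_dvd_coeff μ w).2 fun i => ?_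
    rcases lt_or_ge i n with hi | hi
    · exact hμ i hi
    · simp [coeff_eq_zero_of_natDegree_lt (hw.trans_le hi)]
  have hmonic : ((X : ℤ[X]) ^ n + 1).Monic := by
    simpa using monic_X_pow_add_C (1 : ℤ) hn0
  have hdeg : 0 < ((X : ℤ[X]) ^ n + 1).degree := by
    have := degree_X_pow_add_C (Nat.pos_of_ne_zero hn0) (1 : ℤ)
    rw [C_1] at this
    rw [this]
    exact_mod_cast Nat.pos_of_ne_zero hn0
  rw [mul_left_comm] at hvw
  obtain ⟨c, hc, hdvd⟩ := exists_eq_mul_and_dvd_sub_C_of_monic hmonic hdeg hμpos.ne' hvw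
  refine ⟨⟨c, hc⟩, ?_⟩
  rw [hc, Int.mul_ediv_cancel_left _ hμpos.ne', Ideal.mem_span_singleton]
  refine ⟨Ideal.Quotient.mk _ u, ?_⟩
  rw [← map_mul, eq_comm, Ideal.Quotient.eq, Ideal.mem_span_singleton]
  exact hdvd
end

section
/- Let n be a power of 2, f = x^n + 1, and v ∈ ℤ[x] of degree < n with d = Res(v,f) ≠ 0. Let w = w_0 + w_1x + ⋯ + w_{n−1}x^{n−1} ∈ ℤ[x] be the polynomial of degree < n with v(x)·w(x) ≡ d (mod x^n + 1). If gcd(w_0, w_1, …, w_{n−1}) = 1, then every integer c whose constant polynomial lies in the ideal I generated by v in ℤ[x]/(x^n+1) is a multiple of d; equivalently, |d| is the least positive constant contained in I. -/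
open Polynomial Matrix

/-- Let `n` be a power of 2, `f = x^n+1`, `v ∈ ℤ[x]` of degree `< n`
with `d = Res(v,f) ≠ 0`, and `w` the polynomial of degree `< n` with
`v·w ≡ d (mod x^n+1)`. If `gcd(w_0, w_1, …, w_{n−1}) = 1`, then every integer `c` whose
constant polynomial lies in the ideal `I` generated by `v` in `ℤ[x]/(x^n+1)` is a
multiple of `d` (equivalently, `|d|` is the least positive constant contained in `I`). -/
theorem constants_in_ideal_are_multiples_of_det
    (n : ℕ) (hn : ∃ k : ℕ, n = 2 ^ k)
    (v : Polynomial ℤ) (hv : v.natDegree < n)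
    (d : ℤ) (hd : d = resultantZ v (X ^ n + 1)) (hd0 : d ≠ 0)
    (w : Polynomial ℤ) (hw : w.natDegree < n)
    (hvw : ((X : Polynomial ℤ) ^ n + 1) ∣ v * w - C d)
    (hgcd : Finset.gcd (Finset.range n) (fun i => w.coeff i) = 1) :
    ∀ c : ℤ,
      Ideal.Quotient.mk (Ideal.span {(X : Polynomial ℤ) ^ n + 1}) (C c) ∈
        Ideal.span {Ideal.Quotient.mk (Ideal.span {(X : Polynomial ℤ) ^ n + 1}) v} →
      d ∣ c := by
  have hn0 : n ≠ 0 := by omega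
  have hf : ((X : Polynomial ℤ) ^ n + 1).Monic := by
    simpa using monic_X_pow_add_C (1 : ℤ) hn0
  have hdeg : ((X : Polynomial ℤ) ^ n + 1).natDegree = n := by
    simpa using natDegree_X_pow_add_C (n := n) (r := (1 : ℤ))
  intro c hc
  obtain ⟨q, hq⟩ := Ideal.mem_span_singleton'.mp hc
  obtain ⟨u, rfl⟩ := Ideal.Quotient.mk_surjective q
  rw [← map_mul, Ideal.Quotient.eq, Ideal.mem_span_singleton] at hq
  have hdvd : (X : Polynomial ℤ) ^ n + 1 ∣ c • w - d • u := by
    have h := dvd_sub (hvw.mul_left u) (hq.mul_left w)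
    have e : u * (v * w - C d) - w * (u * v - C c) = c • w - d • u := by
      simp only [smul_eq_C_mul]
      ring
    rwa [e] at h
  have hmod : c • w = d • (u %ₘ ((X : Polynomial ℤ) ^ n + 1)) := by
    have h := (modByMonic_eq_zero_iff_dvd hf).mpr hdvd
    have hwmod : w %ₘ ((X : Polynomial ℤ) ^ n + 1) = w :=
      (modByMonic_eq_self_iff hf).mpr (degree_lt_degree (by rwa [hdeg]))
    rwa [sub_modByMonic, smul_modByMonic, smul_modByMonic, hwmod, sub_eq_zero] at h
  have hgcd_dvd : d ∣ (Finset.range n).gcd fun i => c * w.coeff i := by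
    refine Finset.dvd_gcd fun i _ => ⟨(u %ₘ ((X : Polynomial ℤ) ^ n + 1)).coeff i, ?_⟩
    simpa using congrArg (fun p => p.coeff i) hmod
  rwa [Finset.gcd_mul_left, hgcd, mul_one, dvd_normalize_iff] at hgcd_dvd
end

section
/- Let n be a power of 2, f = x^n + 1, and v ∈ ℤ[x] of degree < n with d = Res(v,f) ≠ 0. Let w = w_0 + w_1x + ⋯ + w_{n−1}x^{n−1} ∈ ℤ[x] be the polynomial of degree < n with v(x)·w(x) ≡ d (mod x^n + 1). Suppose gcd(w_1, d) = 1 and let r ∈ ℤ satisfy r·w_1 ≡ w_0 (mod d). Then r^n ≡ −1 (mod d). -/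
open Polynomial Matrix

/-- If the row combinations of `S` with coefficients `u` and `u'` are both divisible by `det S`,
then so are the `2 × 2` minors of the pair `(u, u')`, up to a factor `u a`. -/
theorem dvd_mul_minor_of_vecMul_eq_smul {ι : Type*} [Fintype ι] [DecidableEq ι]
    (S : Matrix ι ι ℤ) (hS : S.det ≠ 0) (u u' g g' : ι → ℤ)
    (hu : u ᵥ* S = S.det • g) (hu' : u' ᵥ* S = S.det • g') {a b : ι} (hab : a ≠ b) :
    S.det ∣ u a * (u a * u' b - u' a * u b) := by
  set d := S.det with hd
  set A := S.updateRow a (d • g) with hA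
  have hdetA : A.det = u a * d := by
    rw [hA, ← hu, vecMul_eq_sum, det_updateRow_sum, smul_eq_mul]
  let c : ι → ℤ := Function.update (fun k => u a * u' k - u' a * u k) a (u' a)
  have hrow : u a • (d • g') = ∑ k, c k • A k := by
    have hAk : ∀ k, c k • A k = (u a * u' k - u' a * u k) • S k
        + if k = a then u' a • (d • g) else 0 := by
      intro k
      by_cases hk : k = a
      · subst hk
        have h0 : u k * u' k - u' k * u k = 0 := by ring
        simp [c, hA, h0]
      · simp [c, hA, hk]
    simp_rw [hAk, Finset.sum_add_distrib, Finset.sum_ite_eq', Finset.mem_univ, if_true,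
      ← hu, ← hu', vecMul_eq_sum, sub_smul, Finset.sum_sub_distrib, mul_smul, Finset.smul_sum,
      sub_add_cancel]
  have h1 : (A.updateRow b (u a • (d • g'))).det = c b * (u a * d) := by
    rw [hrow, det_updateRow_sum, smul_eq_mul, hdetA]
  have h2 : (A.updateRow b (u a • (d • g'))).det
      = u a * (d * (d * ((S.updateRow b g').updateRow a g).det)) := by
    rw [det_updateRow_smul, det_updateRow_smul, hA, updateRow_comm _ hab, det_updateRow_smul]
  have hc : c b = u a * u' b - u' a * u b := by simp [c, hab.symm]
  refine ⟨u a * ((S.updateRow b g').updateRow a g).det, mul_left_cancel₀ hS ?_⟩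
  rw [← hc]
  linear_combination h2 - h1

theorem sum_coeff_mul_shift_coeff (a p : ℤ[X]) {n : ℕ} (hp : p.degree < n) (k : ℕ) :
    ∑ i : Fin n, p.coeff i * (if (i : ℕ) ≤ k then a.coeff (k - i) else 0) = (a * p).coeff k := by
  have hsum : p = ∑ i ∈ Finset.range n, C (p.coeff i) * X ^ i := by
    ext m
    simp only [finsetSum_coeff, coeff_C_mul_X_pow, Finset.sum_ite_eq, Finset.mem_range]
    split_ifs with h
    · rfl
    · exact coeff_eq_zero_of_degree_lt (hp.trans_le (by exact_mod_cast not_lt.mp h))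
  conv_rhs => rw [hsum]
  rw [Finset.sum_range, Finset.mul_sum, finsetSum_coeff]
  refine Finset.sum_congr rfl fun i _ => ?_
  rw [mul_left_comm, coeff_C_mul, coeff_mul_X_pow']

theorem vecMul_sylvesterMatrix_s17 (a b p q : ℤ[X]) (hp : p.degree < b.natDegree)
    (hq : q.degree < a.natDegree) :
    (fun i : Fin (b.natDegree + a.natDegree) =>
        if (i : ℕ) < b.natDegree then p.coeff i else q.coeff (i - b.natDegree)) ᵥ*
      sylvesterMatrix a b = fun k : Fin (b.natDegree + a.natDegree) => (a * p + b * q).coeff k := by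
  ext k
  rw [coeff_add, ← sum_coeff_mul_shift_coeff a p hp, ← sum_coeff_mul_shift_coeff b q hq]
  simp [vecMul, dotProduct, sylvesterMatrix, Fin.sum_univ_add, Nat.add_comm b.natDegree,
    -Fin.val_fin_le]

theorem resultantZ_dvd_mul_minor (a b p q p' q' g g' : ℤ[X]) (h0 : resultantZ a b ≠ 0)
    (hp : p.degree < b.natDegree) (hq : q.degree < a.natDegree)
    (hp' : p'.degree < b.natDegree) (hq' : q'.degree < a.natDegree)
    (h : a * p + b * q = C (resultantZ a b) * g)
    (h' : a * p' + b * q' = C (resultantZ a b) * g')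
    {i j : ℕ} (hi : i < b.natDegree) (hj : j < b.natDegree) :
    resultantZ a b ∣
      p.coeff i * (p.coeff i * p'.coeff j - p'.coeff i * p.coeff j) := by
  rcases eq_or_ne i j with rfl | hij
  · simp [mul_comm]
  have key := dvd_mul_minor_of_vecMul_eq_smul (sylvesterMatrix a b) h0 _ _
    (fun k => g.coeff k) (fun k => g'.coeff k)
    ((vecMul_sylvesterMatrix_s17 a b p q hp hq).trans ?_)
    ((vecMul_sylvesterMatrix_s17 a b p' q' hp' hq').trans ?_)
    (a := ⟨i, by omega⟩) (b := ⟨j, by omega⟩) (by simpa using hij)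
  · simpa [hi, hj, resultantZ] using key
  · ext k
    rw [h, coeff_C_mul]
    rfl
  · ext k
    rw [h', coeff_C_mul]
    rfl

theorem degree_lt_of_mul_add_monic_mul {a b p q g : ℤ[X]} (hb : b.Monic)
    (hp : p.degree < b.natDegree) (hg : g.degree < (b.natDegree + a.natDegree : ℕ))
    (h : a * p + b * q = g) : q.degree < a.natDegree := by
  have hbq : b * q = g - a * p := by rw [← h]; ring
  have hap : (a * p).degree < (b.natDegree + a.natDegree : ℕ) := by
    rcases eq_or_ne p 0 with rfl | hp0
    · simp only [mul_zero, degree_zero]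
      exact WithBot.bot_lt_coe _
    rcases eq_or_ne a 0 with rfl | ha0
    · simp only [zero_mul, degree_zero]
      exact WithBot.bot_lt_coe _
    rw [degree_mul, degree_eq_natDegree ha0, degree_eq_natDegree hp0]
    rw [degree_eq_natDegree hp0] at hp
    norm_cast at hp ⊢
    omega
  have hlt := (degree_sub_le g (a * p)).trans_lt (max_lt hg hap)
  rw [← hbq] at hlt
  rcases eq_or_ne q 0 with rfl | hq0
  · rw [degree_zero]
    exact WithBot.bot_lt_coe _
  rw [degree_mul, degree_eq_natDegree hb.ne_zero, degree_eq_natDegree hq0] at hlt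
  rw [degree_eq_natDegree hq0]
  norm_cast at hlt ⊢
  omega

theorem pow_modEq_neg_one_of_shift {n : ℕ} (hn : 2 ≤ n) {d r : ℤ} (c : ℕ → ℤ)
    (hc1 : IsCoprime d (c 1)) (hshift : ∀ j, j + 1 < n → c j ≡ r * c (j + 1) [ZMOD d])
    (hwrap : -c (n - 1) ≡ r * c 0 [ZMOD d]) : r ^ n ≡ -1 [ZMOD d] := by
  have hpow : ∀ k, k + 1 < n → c 1 ≡ r ^ k * c (k + 1) [ZMOD d] := by
    intro k
    induction k with
    | zero => intro _; simp
    | succ k ih =>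
      intro hk
      refine (ih (by omega)).trans ?_
      rw [pow_succ, mul_assoc]
      exact (hshift (k + 1) hk).mul_left _
  obtain ⟨m, rfl⟩ := Nat.exists_eq_add_of_le' hn
  have h1 := (hpow m (by omega)).dvd
  have h2 := (hshift 0 (by omega)).dvd
  have h3 := hwrap.dvd
  simp only [zero_add, Nat.add_succ_sub_one] at h2 h3
  refine (Int.modEq_iff_dvd.mpr (hc1.dvd_of_dvd_mul_right ?_))
  have : (-1 - r ^ (m + 2)) * c 1
      = (r ^ m * c (m + 1) - c 1) - r ^ (m + 1) * (r * c 1 - c 0)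
        - r ^ m * (r * c 0 - -c (m + 1)) := by ring
  rw [this]
  exact dvd_sub (dvd_sub h1 (h2.mul_left _)) (h3.mul_left _)

/-- Let `n` be a power of 2, `f = x^n+1`, `v ∈ ℤ[x]` of degree `< n`
with `d = Res(v,f) ≠ 0`, and `w` the polynomial of degree `< n` with
`v·w ≡ d (mod x^n+1)`. If `gcd(w_1, d) = 1` and `r ∈ ℤ` satisfies
`r·w_1 ≡ w_0 (mod d)` (i.e. `r = w_0/w_1 mod d`), then `r^n ≡ −1 (mod d)`. -/
theorem pow_eq_neg_one_of_ratio
    (n : ℕ) (hn : ∃ k : ℕ, n = 2 ^ k)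
    (v : Polynomial ℤ) (hv : v.natDegree < n)
    (d : ℤ) (hd : d = resultantZ v (X ^ n + 1)) (hd0 : d ≠ 0)
    (w : Polynomial ℤ) (hw : w.natDegree < n)
    (hvw : ((X : Polynomial ℤ) ^ n + 1) ∣ v * w - C d)
    (hw1 : Int.gcd (w.coeff 1) d = 1)
    (r : ℤ) (hr : r * w.coeff 1 ≡ w.coeff 0 [ZMOD d]) :
    r ^ n ≡ -1 [ZMOD d] := by
  by_cases hn2 : n < 2
  · have hw10 : w.coeff 1 = 0 := coeff_eq_zero_of_natDegree_lt (by omega)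
    rw [hw10, Int.gcd_zero_left] at hw1
    exact Int.modEq_iff_dvd.mpr ((Int.isUnit_iff_natAbs_eq.mpr hw1).dvd)
  have hn2 : 2 ≤ n := not_lt.mp hn2
  have hcop : IsCoprime d (w.coeff 1) := (Int.isCoprime_iff_gcd_eq_one.mpr hw1).symm
  have hf : ((X : ℤ[X]) ^ n + 1).Monic := monic_X_pow_add_C 1 (by omega)
  have hfd : ((X : ℤ[X]) ^ n + 1).natDegree = n := natDegree_X_pow_add_C (r := (1 : ℤ))
  obtain ⟨q, hq⟩ := hvw
  set f : ℤ[X] := X ^ n + 1 with hfdef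
  let w' : ℤ[X] := X * w - C (w.coeff (n - 1)) * f
  have hw'0 : w'.coeff 0 = -w.coeff (n - 1) := by
    have : 0 ≠ n := by omega
    simp [w', hfdef, coeff_X_pow, this]
  have hw'lt : ∀ j, j + 1 < n → w'.coeff (j + 1) = w.coeff j := by
    intro j hj
    simp [w', hfdef, coeff_X_pow, coeff_one, hj.ne]
  have hwdeg : w.degree < f.natDegree := by
    rw [hfd]
    exact degree_le_natDegree.trans_lt (by exact_mod_cast hw)
  have hw'deg : w'.degree < f.natDegree := by
    rw [hfd, degree_lt_iff_coeff_zero]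
    intro k hk
    obtain ⟨k, rfl⟩ := Nat.exists_eq_add_of_le' (show 1 ≤ k by omega)
    rcases (show n ≤ k + 1 from hk).eq_or_lt with hkn | hlt
    · simp [w', hfdef, hkn, coeff_X_pow, coeff_one]
    · have hk0 : w.coeff k = 0 := coeff_eq_zero_of_natDegree_lt (by omega)
      have : k + 1 ≠ n := by omega
      simp [w', hfdef, coeff_X_pow, coeff_one, this, hk0]
  have hid : v * w + f * -q = C d * 1 := by linear_combination hq
  have hid' : v * w' + f * (-(X * q) + C (w.coeff (n - 1)) * v) = C d * X := by
    simp only [w']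
    linear_combination X * hq
  have hq_deg := degree_lt_of_mul_add_monic_mul hf hwdeg (by
    rw [mul_one]
    refine degree_C_le.trans_lt ?_
    rw [hfd]
    exact_mod_cast (show 0 < n + v.natDegree by omega)) hid
  have hq'_deg := degree_lt_of_mul_add_monic_mul hf hw'deg (by
    refine (degree_C_mul_X_le d).trans_lt ?_
    rw [hfd]
    exact_mod_cast (show 1 < n + v.natDegree by omega)) hid'
  have hratio : ∀ j < n, w'.coeff j ≡ r * w.coeff j [ZMOD d] := by
    intro j hj
    have hminor : d ∣ w.coeff 1 * (w.coeff 1 * w'.coeff j - w'.coeff 1 * w.coeff j) := by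
      rw [hd] at hid hid' hd0 ⊢
      exact resultantZ_dvd_mul_minor v f w _ w' _ _ _ hd0 hwdeg hq_deg hw'deg hq'_deg hid hid'
        (by omega) (by omega)
    have hminor := hcop.dvd_of_dvd_mul_left hminor
    rw [hw'lt 0 (by omega)] at hminor
    refine (Int.modEq_iff_dvd.mpr (hcop.dvd_of_dvd_mul_left ?_)).symm
    have : w.coeff 1 * (w'.coeff j - r * w.coeff j)
        = (w.coeff 1 * w'.coeff j - w.coeff 0 * w.coeff j)
          + w.coeff j * (w.coeff 0 - r * w.coeff 1) := by ring
    rw [this]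
    exact dvd_add hminor (hr.dvd.mul_left _)
  refine pow_modEq_neg_one_of_shift hn2 w.coeff hcop (fun j hj => ?_) ?_
  · rw [← hw'lt j hj]
    exact hratio _ hj
  · rw [← hw'0]
    exact hratio 0 (by omega)
end
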